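/- arXiv:2504.16744 — 7 statements merged into one kernel-verified Lean document; each statement's English description precedes it below -/
import Mathlib

section
/- Let G=(V,E) be a digraph with positive capacities cap, let α ∈ (0,1) be rational, and let A ⊆ E. Then the following are equivalent: (i) for every traffic matrix T that is routable in E, the scaled matrix α·T is routable in A; (ii) the scaled matrix α·T_E is routable in A. -/
open Finset

variable {V : Type*}

/-- A flow for the commodity `(s,t)` of value `d`, supported on the edge set `E`. -/
def IsFlow [Fintype V] [DecidableEq V] (E : Finset (V × V)) (s t : V) (d : ℚ)
    (f : V × V → ℚ) : Prop :=
  (∀ e, 0 ≤ f e) ∧ (∀ e, e ∉ E → f e = 0) ∧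
    ∀ v : V,
      ((∑ e ∈ E.filter (fun e => e.2 = v), f e) -
          ∑ e ∈ E.filter (fun e => e.1 = v), f e) =
        (if v = t then d else 0) - (if v = s then d else 0)

/-- The traffic matrix `T` is routable in the edge set `A ⊆ E` via a multi-commodity flow. -/
def Routable [Fintype V] [DecidableEq V] (E : Finset (V × V)) (cap : V × V → ℚ)
    (T : V × V → ℚ) (A : Finset (V × V)) : Prop :=
  ∃ f : V × V → V × V → ℚ,
    (∀ p : V × V, IsFlow E p.1 p.2 (T p) (f p)) ∧
    (∀ e ∈ E, (∑ p : V × V, f p e) ≤ cap e) ∧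
    (∀ e ∈ E, e ∉ A → (∑ p : V × V, f p e) = 0)

/-- The traffic matrix `T_E` demanding `cap e` for each edge `e ∈ E` and `0` otherwise. -/
def trafficTE [Fintype V] [DecidableEq V] (E : Finset (V × V)) (cap : V × V → ℚ) :
    V × V → ℚ := fun p => if p ∈ E then cap p else 0

/-- A traffic matrix is a nonnegative function on pairs of vertices. -/
def IsTrafficMatrix (T : V × V → ℚ) : Prop := ∀ p, 0 ≤ T p

/-- Each edge carrying its own demand is a flow. -/
theorem isFlow_single [Fintype V] [DecidableEq V] {E : Finset (V × V)} {p : V × V} (hp : p ∈ E)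
    {d : ℚ} (hd : 0 ≤ d) : IsFlow E p.1 p.2 d (fun e => if e = p then d else 0) := by
  refine ⟨fun e => ite_nonneg hd le_rfl, fun e he => if_neg (ne_of_mem_of_not_mem hp he).symm,
    fun v => ?_⟩
  simp only [sum_ite_eq', mem_filter, hp, true_and, eq_comm (b := v)]

theorem isFlow_zero [Fintype V] [DecidableEq V] (E : Finset (V × V)) (s t : V) :
    IsFlow E s t 0 (fun _ => 0) := by
  simp [IsFlow]

theorem routable_trafficTE [Fintype V] [DecidableEq V] {E : Finset (V × V)} {cap : V × V → ℚ}
    (hcap : ∀ e ∈ E, 0 ≤ cap e) : Routable E cap (trafficTE E cap) E := by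
  refine ⟨fun p e => if e = p then trafficTE E cap p else 0, fun p => ?_, fun e he => ?_,
    fun e he hne => absurd he hne⟩
  · by_cases hp : p ∈ E
    · simpa [trafficTE, hp] using isFlow_single hp (hcap p hp)
    · simpa [trafficTE, hp] using isFlow_zero E p.1 p.2
  · simp [trafficTE, he]

/-- The net inflow at `v` of a flow is the sum of the contributions of its edges. -/
theorem sum_filter_sub_sum_filter [DecidableEq V] (E : Finset (V × V)) (f : V × V → ℚ) (v : V) :
    ((∑ e ∈ E.filter (fun e => e.2 = v), f e) - ∑ e ∈ E.filter (fun e => e.1 = v), f e) =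
      ∑ e ∈ E, f e * ((if v = e.2 then 1 else 0) - (if v = e.1 then 1 else 0)) := by
  simp only [sum_filter, ← sum_sub_distrib, mul_sub, mul_ite, mul_one, mul_zero, eq_comm]

/-- Rerouting every edge `e'` of a flow `f` along a flow `g e'` of value `α * cap e'` scales the
value of `f` by `α`. -/
theorem IsFlow.reroute [Fintype V] [DecidableEq V] {E : Finset (V × V)} {cap : V × V → ℚ}
    (hcap : ∀ e ∈ E, 0 < cap e) {α : ℚ} {g : V × V → V × V → ℚ}
    (hg : ∀ e ∈ E, IsFlow E e.1 e.2 (α * cap e) (g e)) {s t : V} {d : ℚ} {f : V × V → ℚ}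
    (hf : IsFlow E s t d f) :
    IsFlow E s t (α * d) (fun e => ∑ e' ∈ E, f e' / cap e' * g e' e) := by
  refine ⟨fun e => sum_nonneg fun e' he' =>
      mul_nonneg (div_nonneg (hf.1 e') (hcap e' he').le) ((hg e' he').1 e),
    fun e he => sum_eq_zero fun e' he' => by rw [(hg e' he').2.1 e he, mul_zero], fun v => ?_⟩
  have hfv := hf.2.2 v
  rw [sum_filter_sub_sum_filter] at hfv
  rw [sum_comm, sum_comm (s := E.filter fun e => e.1 = v), ← sum_sub_distrib]
  simp only [← mul_sum, ← mul_sub]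
  calc ∑ e' ∈ E, f e' / cap e' * ((∑ e ∈ E.filter (fun e => e.2 = v), g e' e) -
          ∑ e ∈ E.filter (fun e => e.1 = v), g e' e)
      = ∑ e' ∈ E, α * (f e' * ((if v = e'.2 then 1 else 0) - (if v = e'.1 then 1 else 0))) := by
        refine sum_congr rfl fun e' he' => ?_
        have hc := (hcap e' he').ne'
        rw [(hg e' he').2.2 v]
        split_ifs <;> field_simp <;> ring
    _ = (if v = t then α * d else 0) - (if v = s then α * d else 0) := by
        rw [← mul_sum, hfv, mul_sub, mul_ite, mul_ite, mul_zero]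

theorem Routable.of_trafficTE [Fintype V] [DecidableEq V] {E A : Finset (V × V)}
    {cap : V × V → ℚ} (hcap : ∀ e ∈ E, 0 < cap e) {α : ℚ}
    (hA : Routable E cap (fun p => α * trafficTE E cap p) A) {T : V × V → ℚ}
    (hT : Routable E cap T E) : Routable E cap (fun p => α * T p) A := by
  obtain ⟨g, hg, hgcap, hgA⟩ := hA
  obtain ⟨f, hf, hfcap, -⟩ := hT
  have hgE : ∀ e ∈ E, IsFlow E e.1 e.2 (α * cap e) (g e) := fun e he => by
    simpa [trafficTE, he] using hg e
  refine ⟨fun p e => ∑ e' ∈ E, f p e' / cap e' * g e' e, fun p => (hf p).reroute hcap hgE,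
    fun e he => ?_, fun e he heA => ?_⟩
  · calc ∑ p, ∑ e' ∈ E, f p e' / cap e' * g e' e
        = ∑ e' ∈ E, (∑ p, f p e') / cap e' * g e' e := by
          rw [sum_comm]
          simp only [← sum_mul, ← sum_div]
      _ ≤ ∑ e' ∈ E, g e' e := sum_le_sum fun e' he' =>
          mul_le_of_le_one_left ((hg e').1 e) ((div_le_one (hcap e' he')).2 (hfcap e' he'))
      _ ≤ ∑ e', g e' e := sum_le_sum_of_subset_of_nonneg (subset_univ E) fun e' _ _ => (hg e').1 e
      _ ≤ cap e := hgcap e he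
  · have hzero := (sum_eq_zero_iff_of_nonneg fun e' _ => (hg e').1 e).1 (hgA e he heA)
    exact sum_eq_zero fun p _ => sum_eq_zero fun e' _ => by rw [hzero e' (mem_univ e'), mul_zero]

theorem stmt0 [Fintype V] [DecidableEq V] (E : Finset (V × V))
    (hE : ∀ e ∈ E, e.1 ≠ e.2) (cap : V × V → ℚ) (hcap : ∀ e ∈ E, 0 < cap e)
    (α : ℚ) (h0 : 0 < α) (h1 : α < 1) (A : Finset (V × V)) (hA : A ⊆ E) :
    (∀ T : V × V → ℚ, IsTrafficMatrix T → Routable E cap T E →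
        Routable E cap (fun p => α * T p) A) ↔
      Routable E cap (fun p => α * trafficTE E cap p) A := by
  refine ⟨fun h => h _ (fun p => ?_) (routable_trafficTE fun e he => (hcap e he).le),
    fun h T _ hT => h.of_trafficTE hcap hT⟩
  unfold trafficTE
  split_ifs with hp
  exacts [(hcap p hp).le, le_rfl]
end

section
/- Let G=(V,E) be a digraph with positive capacities cap, let A ⊆ E, and let T be a traffic matrix that is routable in A and satisfies T(s,t) ≤ cap(s,t) for every edge (s,t) ∈ E. Then there exists an MCF (f_{s,t})_{(s,t)∈V×V} for (G,cap,T) with Σ_{(s,t)} f_{s,t}(e) = 0 for every e ∈ E∖A which additionally satisfies f_{s,t}((s,t)) = T(s,t) for every edge (s,t) ∈ A. -/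
open Finset

variable {V : Type*}

/-- The net inflow of `f` at the vertex `v`. -/
def netInflow [DecidableEq V] (E : Finset (V × V)) (f : V × V → ℚ) (v : V) : ℚ :=
  (∑ e ∈ E.filter (fun e => e.2 = v), f e) - ∑ e ∈ E.filter (fun e => e.1 = v), f e

theorem netInflow_add [DecidableEq V] (E : Finset (V × V)) (f g : V × V → ℚ) (v : V) :
    netInflow E (f + g) v = netInflow E f v + netInflow E g v := by
  simp only [netInflow, Pi.add_apply, sum_add_distrib]
  ring

theorem netInflow_smul [DecidableEq V] (E : Finset (V × V)) (a : ℚ) (f : V × V → ℚ) (v : V) :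
    netInflow E (a • f) v = a * netInflow E f v := by
  simp only [netInflow, Pi.smul_apply, smul_eq_mul, ← mul_sum]
  ring

theorem netInflow_sub [DecidableEq V] (E : Finset (V × V)) (f g : V × V → ℚ) (v : V) :
    netInflow E (f - g) v = netInflow E f v - netInflow E g v := by
  simp only [netInflow, Pi.sub_apply, sum_sub_distrib]
  ring

/-- Sending `d` units along the single edge `e` is a flow for `e`. -/
theorem isFlow_single_s1 [Fintype V] [DecidableEq V] {E : Finset (V × V)} {e : V × V} (he : e ∈ E)
    {d : ℚ} (hd : 0 ≤ d) : IsFlow E e.1 e.2 d (Pi.single e d) := by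
  refine ⟨fun e' => ?_, fun e' he' => ?_, fun v => ?_⟩
  · by_cases h : e' = e
    · subst h; simpa using hd
    · simp [h]
  · have h : e' ≠ e := fun h => he' (h ▸ he)
    simp [h]
  · simp [Pi.single_apply, he, eq_comm]

/-- Adding a nonnegative multiple of the difference of two flows of the same value does not change
the value of a flow. -/
theorem IsFlow.add_smul_sub [Fintype V] [DecidableEq V] {E : Finset (V × V)} {s t s' t' : V}
    {d d' a : ℚ} {f g h : V × V → ℚ} (hf : IsFlow E s t d f) (hg : IsFlow E s' t' d' g)
    (hh : IsFlow E s' t' d' h) (hnonneg : ∀ e, 0 ≤ f e + a * (g e - h e)) :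
    IsFlow E s t d (f + a • (g - h)) := by
  refine ⟨hnonneg, fun e he => ?_, fun v => ?_⟩
  · simp [hf.2.1 e he, hg.2.1 e he, hh.2.1 e he]
  · change netInflow E (f + a • (g - h)) v = _
    have h1 : netInflow E f v = _ := hf.2.2 v
    have h2 : netInflow E g v = _ := hg.2.2 v
    have h3 : netInflow E h v = _ := hh.2.2 v
    rw [netInflow_add, netInflow_smul, netInflow_sub, h1, h2, h3]
    ring

/-- A multi-commodity flow respecting the capacities `c` can be rerouted so that the demand of the
edge `e` is sent along `e`, without decreasing what any other commodity sends along its own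
edge. -/
theorem exists_reroute [Fintype V] [DecidableEq V] {E : Finset (V × V)} {c T : V × V → ℚ}
    {f : V × V → V × V → ℚ} (hf : ∀ p : V × V, IsFlow E p.1 p.2 (T p) (f p))
    (hc : ∀ e ∈ E, ∑ p, f p e ≤ c e) {e : V × V} (he : e ∈ E) (hT : 0 ≤ T e) (hTc : T e ≤ c e) :
    ∃ f' : V × V → V × V → ℚ, (∀ p : V × V, IsFlow E p.1 p.2 (T p) (f' p)) ∧
      (∀ e' ∈ E, ∑ p, f' p e' ≤ c e') ∧ T e ≤ f' e e ∧ ∀ p ≠ e, f p p ≤ f' p p := by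
  rcases le_or_gt (T e) (f e e) with hle | hlt
  · exact ⟨f, hf, hc, hle, fun _ _ => le_rfl⟩
  have split : ∀ (g : V × V → ℚ), ∑ p, g p = g e + ∑ p ∈ univ.erase e, g p := fun g =>
    (add_sum_erase _ _ (mem_univ e)).symm
  set r := T e - f e e with hr
  set g := ∑ p ∈ univ.erase e, f p e with hg
  have hr0 : 0 < r := sub_pos.2 hlt
  have hm : 0 < max r g := lt_max_of_lt_left hr0
  set a := (max r g)⁻¹ with ha
  have ha0 : 0 < a := inv_pos.2 hm
  have har : a * r ≤ 1 := by
    rw [ha, inv_mul_le_one₀ hm]; exact le_max_left _ _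
  have hag : a * g ≤ 1 := by
    rw [ha, inv_mul_le_one₀ hm]; exact le_max_right _ _
  have hce : f e e + g ≤ c e := by
    have := hc e he
    rwa [split] at this
  have hcap : T e + (g - a * g * r) ≤ c e := by
    rcases le_total g r with h | h
    · have : a * r = 1 := by rw [ha, max_eq_left h, inv_mul_cancel₀ hr0.ne']
      linear_combination hTc - g * this
    · have : a * g = 1 := by
        rw [ha, max_eq_right h, inv_mul_cancel₀ (hr0.trans_le h).ne']
      linear_combination hce - r * this
  let f' : V × V → V × V → ℚ := fun p =>
    if p = e then Pi.single e (T e) else f p + (a * f p e) • (f e - Pi.single e (T e))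
  have f'_self : f' e = Pi.single e (T e) := if_pos rfl
  have f'_ne : ∀ p ≠ e, f' p = f p + (a * f p e) • (f e - Pi.single e (T e)) := fun p hp =>
    if_neg hp
  have f'_apply_self : ∀ p ≠ e, f' p e = f p e - a * f p e * r := fun p hp => by
    simp only [f'_ne p hp, Pi.add_apply, Pi.smul_apply, Pi.sub_apply, Pi.single_eq_same,
      smul_eq_mul, hr]
    ring
  have f'_apply_ne : ∀ p ≠ e, ∀ e' ≠ e, f' p e' = f p e' + a * f p e * f e e' :=
    fun p hp e' he' => by simp [f'_ne p hp, he']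
  refine ⟨f', fun p => ?_, fun e' he' => ?_, ?_, fun p hp => ?_⟩
  · by_cases hp : p = e
    · subst hp
      rw [f'_self]
      exact isFlow_single_s1 he hT
    · have hnonneg : ∀ e', 0 ≤ f' p e' := fun e' => by
        by_cases h : e' = e
        · subst h
          rw [f'_apply_self p hp]
          nlinarith [(hf p).1 e']
        · rw [f'_apply_ne p hp e' h]
          have h1 := (hf p).1 e'
          have h2 := (hf p).1 e
          have h3 := (hf e).1 e'
          positivity
      rw [f'_ne p hp] at hnonneg ⊢
      exact (hf p).add_smul_sub (hf e) (isFlow_single_s1 he hT) hnonneg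
  · rw [split]
    by_cases h : e' = e
    · subst h
      rw [sum_congr rfl fun p hp => f'_apply_self p (ne_of_mem_erase hp), sum_sub_distrib,
        ← sum_mul, ← mul_sum, f'_self, Pi.single_eq_same]
      exact hcap
    · rw [sum_congr rfl fun p hp => f'_apply_ne p (ne_of_mem_erase hp) e' h, sum_add_distrib,
        ← sum_mul, ← mul_sum, f'_self, Pi.single_eq_of_ne h]
      have h1 := hc e' he'
      rw [split] at h1
      have h2 := mul_le_mul_of_nonneg_right hag ((hf e).1 e')
      linarith
  · simp [f'_self]
  · rw [f'_apply_ne p hp p hp]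
    have h1 := (hf p).1 e
    have h2 := (hf e).1 p
    exact le_add_of_nonneg_right (by positivity)

/-- A multi-commodity flow respecting the capacities `c` can be rerouted so that every edge of `A`
carries its own demand. -/
theorem exists_reroute_finset [Fintype V] [DecidableEq V] {E : Finset (V × V)} {c T : V × V → ℚ}
    {f : V × V → V × V → ℚ} (hf : ∀ p : V × V, IsFlow E p.1 p.2 (T p) (f p))
    (hc : ∀ e ∈ E, ∑ p, f p e ≤ c e) (hT : IsTrafficMatrix T) (A : Finset (V × V)) (hA : A ⊆ E)
    (hTc : ∀ e ∈ A, T e ≤ c e) :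
    ∃ f' : V × V → V × V → ℚ, (∀ p : V × V, IsFlow E p.1 p.2 (T p) (f' p)) ∧
      (∀ e ∈ E, ∑ p, f' p e ≤ c e) ∧ ∀ e ∈ A, T e ≤ f' e e := by
  induction A using Finset.induction_on with
  | empty => exact ⟨f, hf, hc, by simp⟩
  | insert e A _ ih =>
    obtain ⟨f₁, hf₁, hc₁, hA₁⟩ := ih ((subset_insert e A).trans hA)
      fun e' he' => hTc e' (mem_insert_of_mem he')
    obtain ⟨f₂, hf₂, hc₂, he₂, hmono⟩ := exists_reroute hf₁ hc₁ (hA (mem_insert_self e A)) (hT e)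
      (hTc e (mem_insert_self e A))
    refine ⟨f₂, hf₂, hc₂, fun e' he' => ?_⟩
    by_cases h : e' = e
    · exact h ▸ he₂
    · exact (hA₁ e' (mem_of_mem_insert_of_ne he' h)).trans (hmono e' h)

theorem stmt1 [Fintype V] [DecidableEq V] (E : Finset (V × V))
    (hE : ∀ e ∈ E, e.1 ≠ e.2) (cap : V × V → ℚ) (hcap : ∀ e ∈ E, 0 < cap e)
    (A : Finset (V × V)) (hA : A ⊆ E)
    (T : V × V → ℚ) (hT : IsTrafficMatrix T) (hTcap : ∀ e ∈ E, T e ≤ cap e)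
    (hroutable : Routable E cap T A) :
    ∃ f : V × V → V × V → ℚ,
      (∀ p : V × V, IsFlow E p.1 p.2 (T p) (f p)) ∧
      (∀ e ∈ E, (∑ p : V × V, f p e) ≤ cap e) ∧
      (∀ e ∈ E, e ∉ A → (∑ p : V × V, f p e) = 0) ∧
      (∀ e ∈ A, f e e = T e) := by
  obtain ⟨f₀, hf₀, hcap₀, hzero₀⟩ := hroutable
  obtain ⟨f, hf, hc, hfA⟩ := exists_reroute_finset (c := fun e => if e ∈ A then cap e else 0) hf₀
    (fun e he => by
      by_cases h : e ∈ A
      · simpa [h] using hcap₀ e he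
      · simpa [h] using (hzero₀ e he h).le)
    hT A hA (fun e he => by simpa [he] using hTcap e (hA he))
  let f' : V × V → V × V → ℚ := fun p => if p ∈ A then Pi.single p (T p) else f p
  have hf' : ∀ p : V × V, IsFlow E p.1 p.2 (T p) (f' p) := fun p => by
    by_cases h : p ∈ A
    · simpa [f', h] using isFlow_single_s1 (hA h) (hT p)
    · simpa [f', h] using hf p
  have hle : ∀ p e, f' p e ≤ f p e := fun p e => by
    by_cases h : p ∈ A
    · by_cases hpe : e = p
      · subst hpe
        simpa [f', h] using hfA e h
      · simpa [f', h, hpe] using (hf p).1 e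
    · simp [f', h]
  have hc' : ∀ e ∈ E, ∑ p, f' p e ≤ if e ∈ A then cap e else 0 := fun e he =>
    (sum_le_sum fun p _ => hle p e).trans (hc e he)
  refine ⟨f', hf', fun e he => (hc' e he).trans ?_, fun e he heA => ?_, fun e he => ?_⟩
  · split_ifs
    · exact le_rfl
    · exact (hcap e he).le
  · exact le_antisymm (by simpa [heA] using hc' e he) (sum_nonneg fun p _ => (hf' p).1 e)
  · simp [f', he]
end

section
/- Let G=(V,E) be a directed multigraph with positive capacities cap and α ∈ (0,1) rational. Let O be an optimal feasible MMCFS solution for (G,cap,α) and A a feasible MMCFS solution with A ≠ O. Then A∖O is nonempty and both of the following inequalities hold: |A| ≤ (1 + (1−α)/α) · (mc(O)/mc(A)) · |O|, and |A| ≤ |O| + ((1−α)/α) · (mc(O)/mc(A∖O)) · |O|. -/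
open Finset

/-- The per-edge demand function `D` is routable in `A` in the directed multigraph
given by `src`, `dst` on the edge type `K`, with capacities `cap`. -/
def MRoutable {V K : Type*} [Fintype V] [DecidableEq V] [Fintype K] [DecidableEq K]
    (src dst : K → V) (cap : K → ℚ) (D : K → ℚ) (A : Finset K) : Prop :=
  ∃ f : K → K → ℚ,
    (∀ k e, 0 ≤ f k e) ∧
    (∀ (k : K) (v : V),
      ((∑ e ∈ Finset.univ.filter (fun e => dst e = v), f k e) -
          ∑ e ∈ Finset.univ.filter (fun e => src e = v), f k e) =
        (if v = dst k then D k else 0) - (if v = src k then D k else 0)) ∧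
    (∀ e, (∑ k, f k e) ≤ cap e) ∧
    (∀ e, e ∉ A → (∑ k, f k e) = 0)

/-- `A` is a feasible MMCFS solution in the multigraph setting: the demand
`k ↦ α · cap k` is routable in `A`. -/
def MFeasible {V K : Type*} [Fintype V] [DecidableEq V] [Fintype K] [DecidableEq K]
    (src dst : K → V) (cap : K → ℚ) (α : ℚ) (A : Finset K) : Prop :=
  MRoutable src dst cap (fun k => α * cap k) A

/-- The mean capacity of a finite set of edges. -/
def meanCapM {K : Type*} (cap : K → ℚ) (S : Finset K) : ℚ := (∑ e ∈ S, cap e) / S.card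

/-- The total demand of a routable demand function is at most the total capacity of the
edges it is routed in. -/
theorem MRoutable.sum_demand_le {V K : Type*} [Fintype V] [DecidableEq V] [Fintype K]
    [DecidableEq K] {src dst : K → V} (hsd : ∀ e, src e ≠ dst e) {cap D : K → ℚ}
    {A : Finset K} (h : MRoutable src dst cap D A) : ∑ k, D k ≤ ∑ e ∈ A, cap e := by
  obtain ⟨f, hf, hbal, hle, hzero⟩ := h
  have hD : ∀ k, D k ≤ ∑ e, f k e := by
    intro k
    have hb := hbal k (dst k)
    rw [if_pos rfl, if_neg (hsd k).symm] at hb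
    have hout : 0 ≤ ∑ e ∈ Finset.univ.filter (fun e => src e = dst k), f k e :=
      Finset.sum_nonneg fun e _ => hf k e
    have hin : ∑ e ∈ Finset.univ.filter (fun e => dst e = dst k), f k e ≤ ∑ e, f k e :=
      Finset.sum_le_sum_of_subset_of_nonneg (Finset.filter_subset _ _) fun e _ _ => hf k e
    linarith
  calc ∑ k, D k ≤ ∑ k, ∑ e, f k e := Finset.sum_le_sum fun k _ => hD k
    _ = ∑ e, ∑ k, f k e := Finset.sum_comm
    _ = ∑ e ∈ A, ∑ k, f k e :=
      (Finset.sum_subset (Finset.subset_univ A) fun e _ he => hzero e he).symm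
    _ ≤ ∑ e ∈ A, cap e := Finset.sum_le_sum fun e _ => hle e

theorem meanCapM_mul_card {K : Type*} (cap : K → ℚ) (S : Finset K) :
    meanCapM cap S * S.card = ∑ e ∈ S, cap e := by
  rcases S.eq_empty_or_nonempty with rfl | hS
  · simp
  · have : (S.card : ℚ) ≠ 0 := by exact_mod_cast hS.card_pos.ne'
    exact div_mul_cancel₀ _ this

theorem meanCapM_pos {K : Type*} {cap : K → ℚ} (hcap : ∀ e, 0 < cap e) {S : Finset K}
    (hS : S.Nonempty) : 0 < meanCapM cap S :=
  div_pos (Finset.sum_pos (fun e _ => hcap e) hS) (by exact_mod_cast hS.card_pos)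

/-- A bound on total capacities turns into a bound on cardinalities via mean capacities. -/
theorem card_le_of_sum_cap_le {K : Type*} {cap : K → ℚ} (hcap : ∀ e, 0 < cap e)
    {S T : Finset K} (hS : S.Nonempty) {c : ℚ}
    (h : ∑ e ∈ S, cap e ≤ c * ∑ e ∈ T, cap e) :
    (S.card : ℚ) ≤ c * (meanCapM cap T / meanCapM cap S) * T.card := by
  have hpos := meanCapM_pos hcap hS
  rw [← meanCapM_mul_card cap S, ← meanCapM_mul_card cap T] at h
  have heq : c * (meanCapM cap T / meanCapM cap S) * T.card =
      c * (meanCapM cap T * T.card) / meanCapM cap S := by ring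
  rw [heq, le_div_iff₀ hpos]
  linarith

theorem stmt3 {V K : Type*} [Fintype V] [DecidableEq V] [Fintype K] [DecidableEq K]
    (src dst : K → V) (hsd : ∀ e, src e ≠ dst e)
    (cap : K → ℚ) (hcap : ∀ e, 0 < cap e)
    (α : ℚ) (h0 : 0 < α) (h1 : α < 1) (O A : Finset K)
    (hOfeas : MFeasible src dst cap α O)
    (hOopt : ∀ B : Finset K, MFeasible src dst cap α B → O.card ≤ B.card)
    (hAfeas : MFeasible src dst cap α A) (hne : A ≠ O) :
    (A \ O).Nonempty ∧
      (A.card : ℚ) ≤ (1 + (1 - α) / α) * (meanCapM cap O / meanCapM cap A) * O.card ∧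
      (A.card : ℚ) ≤
        O.card + (1 - α) / α * (meanCapM cap O / meanCapM cap (A \ O)) * O.card := by
  have hAO : (A \ O).Nonempty := by
    rw [Finset.sdiff_nonempty]
    exact fun hsub => hne (Finset.eq_of_subset_of_card_le hsub (hOopt A hAfeas))
  have hunion : α * (∑ e ∈ A \ O, cap e + ∑ e ∈ O, cap e) ≤ ∑ e ∈ O, cap e := by
    have htotal := MRoutable.sum_demand_le hsd hOfeas
    rw [← Finset.mul_sum] at htotal
    refine le_trans (mul_le_mul_of_nonneg_left ?_ h0.le) htotal
    rw [← Finset.sum_union Finset.sdiff_disjoint]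
    exact Finset.sum_le_sum_of_subset_of_nonneg (Finset.subset_univ _)
      fun e _ _ => (hcap e).le
  have hdiff : ∑ e ∈ A \ O, cap e ≤ (1 - α) / α * ∑ e ∈ O, cap e := by
    rw [div_mul_eq_mul_div, le_div_iff₀ h0]
    linarith
  have hA : ∑ e ∈ A, cap e ≤ (1 + (1 - α) / α) * ∑ e ∈ O, cap e := by
    have hsub : ∑ e ∈ A, cap e ≤ ∑ e ∈ A \ O, cap e + ∑ e ∈ O, cap e := by
      rw [← Finset.sum_union Finset.sdiff_disjoint, Finset.sdiff_union_self_eq_union]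
      exact Finset.sum_le_sum_of_subset_of_nonneg Finset.subset_union_left
        fun e _ _ => (hcap e).le
    linarith
  refine ⟨hAO, card_le_of_sum_cap_le hcap (hAO.mono Finset.sdiff_subset) hA, ?_⟩
  have hcard : (A.card : ℚ) ≤ O.card + (A \ O).card := by
    have := Finset.card_le_card_sdiff_add_card (s := A) (t := O)
    exact_mod_cast this.trans_eq (Nat.add_comm _ _)
  linarith [card_le_of_sum_cap_le hcap hAO hdiff]
end

section
/- Let G=(V,E) be a digraph with positive capacities cap and α ∈ (0,1) rational. Suppose (s,t) ∈ E is an edge such that the digraph (V, E∖{(s,t)}) contains no directed path from s to t. Then every A ⊆ E in which the scaled matrix α·T_E is routable satisfies (s,t) ∈ A; in particular, every feasible MMCFS solution for (G,cap,α) contains (s,t). -/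
open Finset

variable {V : Type*}

/-- A flow of positive value from `s` to `t` uses an edge outside `F` whenever `t` is not reachable
from `s` in `F`. -/
theorem IsFlow.exists_ne_zero_of_not_reachable [Fintype V] [DecidableEq V]
    {E F : Finset (V × V)} {s t : V} {d : ℚ} {f : V × V → ℚ} (hf : IsFlow E s t d f) (hd : 0 < d)
    (hnopath : ¬ Relation.ReflTransGen (fun u v : V => (u, v) ∈ F) s t) :
    ∃ e ∈ E, e ∉ F ∧ f e ≠ 0 := by
  classical
  by_contra! hzero
  obtain ⟨hnonneg, -, hcons⟩ := hf
  set R : Finset V := univ.filter (Relation.ReflTransGen (fun u v : V => (u, v) ∈ F) s) with hR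
  have hs : s ∈ R := by simp [hR, Relation.ReflTransGen.refl]
  have ht : t ∉ R := by simpa [hR] using hnopath
  have hsum := Finset.sum_congr (rfl : R = R) fun v _ => hcons v
  have fiber (g : V × V → V) :
      ∑ v ∈ R, ∑ e ∈ E.filter (fun e => g e = v), f e = ∑ e ∈ E, if g e ∈ R then f e else 0 := by
    simp_rw [Finset.sum_filter]
    rw [Finset.sum_comm]
    simp
  rw [Finset.sum_sub_distrib, Finset.sum_sub_distrib, fiber, fiber] at hsum
  simp only [Finset.sum_ite_eq', hs, ht, if_true, if_false] at hsum
  have hle : (∑ e ∈ E, if e.1 ∈ R then f e else 0) ≤ ∑ e ∈ E, if e.2 ∈ R then f e else 0 := by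
    refine Finset.sum_le_sum fun e he => ?_
    by_cases h1 : e.1 ∈ R
    · by_cases heF : e ∈ F
      · have h2 : e.2 ∈ R := by
          simp only [hR, mem_filter, mem_univ, true_and] at h1 ⊢
          exact h1.tail heF
        simp [h1, h2]
      · simp [hzero e he heF]
    · rw [if_neg h1]
      split_ifs
      exacts [hnonneg e, le_rfl]
  linarith

/-- If `(s, t)` is the only way from `s` to `t`, any edge set in which a matrix with positive demand
`(s, t)` is routable contains `(s, t)`. -/
theorem Routable.mem_of_not_reachable [Fintype V] [DecidableEq V]
    {E A : Finset (V × V)} {cap T : V × V → ℚ} {s t : V} (hA : Routable E cap T A)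
    (hT : 0 < T (s, t))
    (hnopath : ¬ Relation.ReflTransGen (fun u v : V => (u, v) ∈ E.erase (s, t)) s t) :
    (s, t) ∈ A := by
  obtain ⟨f, hflow, -, hzero⟩ := hA
  obtain ⟨e, he, heF, hne⟩ := (hflow (s, t)).exists_ne_zero_of_not_reachable hT hnopath
  obtain rfl : e = (s, t) := by
    by_contra h
    exact heF (mem_erase.2 ⟨h, he⟩)
  by_contra hmem
  exact hne ((Finset.sum_eq_zero_iff_of_nonneg fun p _ => (hflow p).1 _).1 (hzero _ he hmem) _
    (mem_univ _))

theorem stmt7 [Fintype V] [DecidableEq V] (E : Finset (V × V))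
    (hE : ∀ e ∈ E, e.1 ≠ e.2) (cap : V × V → ℚ) (hcap : ∀ e ∈ E, 0 < cap e)
    (α : ℚ) (h0 : 0 < α) (h1 : α < 1) (s t : V) (hst : (s, t) ∈ E)
    (hnopath : ¬ Relation.ReflTransGen (fun u v : V => (u, v) ∈ E.erase (s, t)) s t) :
    (∀ A ⊆ E, Routable E cap (fun p => α * trafficTE E cap p) A → (s, t) ∈ A) ∧
      (∀ A ⊆ E,
        (∀ T : V × V → ℚ, IsTrafficMatrix T → Routable E cap T E →
          Routable E cap (fun p => α * T p) A) → (s, t) ∈ A) := by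
  have hpos : 0 < α * trafficTE E cap (s, t) := by
    simpa [trafficTE, hst] using mul_pos h0 (hcap _ hst)
  refine ⟨fun A _ hA => hA.mem_of_not_reachable hpos hnopath, fun A _ hA => ?_⟩
  refine (hA (trafficTE E cap) (fun p => ?_)
    (routable_trafficTE fun e he => (hcap e he).le)).mem_of_not_reachable hpos hnopath
  unfold trafficTE
  split_ifs with hp
  exacts [(hcap p hp).le, le_rfl]
end

section
/- Let G=(V,E) be a digraph with positive capacities cap and α ∈ (0,1) rational. If O ⊆ E is a set in which the scaled matrix α·T_E is routable, then 2α · Σ_{e∈E∖O} cap(e) ≤ (1−α) · Σ_{e∈O} cap(e). -/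
open Finset

variable {V : Type*}

section FlowVolume

variable [Fintype V] [DecidableEq V] {E : Finset (V × V)} {s t : V} {d : ℚ} {f : V × V → ℚ}

/-- The total flow leaving the source is at least the value of the flow. -/
lemma IsFlow.le_sum_source (hf : IsFlow E s t d f) (hst : s ≠ t) :
    d ≤ ∑ e ∈ E with e.1 = s, f e := by
  have h := hf.2.2 s
  rw [if_neg hst, if_pos rfl] at h
  have : 0 ≤ ∑ e ∈ E with e.2 = s, f e := sum_nonneg fun e _ => hf.1 e
  linarith

/-- The total flow entering the sink is at least the value of the flow. -/
lemma IsFlow.le_sum_sink (hf : IsFlow E s t d f) (hst : s ≠ t) :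
    d ≤ ∑ e ∈ E with e.2 = t, f e := by
  have h := hf.2.2 t
  rw [if_pos rfl, if_neg hst.symm] at h
  have : 0 ≤ ∑ e ∈ E with e.1 = t, f e := sum_nonneg fun e _ => hf.1 e
  linarith

/-- The total volume of a flow is at least its value. -/
lemma IsFlow.le_sum (hf : IsFlow E s t d f) (hst : s ≠ t) : d ≤ ∑ e ∈ E, f e :=
  (hf.le_sum_source hst).trans <|
    sum_le_sum_of_subset_of_nonneg (filter_subset _ _) fun e _ _ => hf.1 e

/-- A flow avoiding the direct edge from source to sink uses at least two edges per unit. -/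
lemma IsFlow.two_mul_le_sum (hf : IsFlow E s t d f) (hst : s ≠ t) (h0 : f (s, t) = 0) :
    2 * d ≤ ∑ e ∈ E, f e := by
  have hsum : ∑ e ∈ E with e.1 = s, f e + ∑ e ∈ E with e.2 = t, f e ≤ ∑ e ∈ E, f e := by
    rw [sum_filter, sum_filter, ← sum_add_distrib]
    refine sum_le_sum fun e _ => ?_
    have he := hf.1 e
    by_cases h1 : e.1 = s
    · by_cases h2 : e.2 = t
      · obtain rfl : e = (s, t) := Prod.ext h1 h2
        simp [h0]
      · simp [h1, h2]
    · by_cases h2 : e.2 = t <;> simp [h1, h2, he]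
  linarith [hf.le_sum_source hst, hf.le_sum_sink hst]

end FlowVolume

theorem stmt9 [Fintype V] [DecidableEq V] (E : Finset (V × V))
    (hE : ∀ e ∈ E, e.1 ≠ e.2) (cap : V × V → ℚ) (hcap : ∀ e ∈ E, 0 < cap e)
    (α : ℚ) (h0 : 0 < α) (h1 : α < 1) (O : Finset (V × V)) (hO : O ⊆ E)
    (hroutable : Routable E cap (fun p => α * trafficTE E cap p) O) :
    2 * α * (∑ e ∈ E \ O, cap e) ≤ (1 - α) * ∑ e ∈ O, cap e := by
  obtain ⟨f, hf, hle, hzero⟩ := hroutable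
  have hval : ∀ p ∈ E, α * trafficTE E cap p = α * cap p := fun p hp => by
    rw [trafficTE, if_pos hp]
  have hupper : ∑ p ∈ E, ∑ e ∈ E, f p e ≤ ∑ e ∈ O, cap e :=
    calc ∑ p ∈ E, ∑ e ∈ E, f p e
        ≤ ∑ p, ∑ e ∈ E, f p e :=
          sum_le_sum_of_subset_of_nonneg (subset_univ _)
            fun p _ _ => sum_nonneg fun e _ => (hf p).1 e
      _ = ∑ e ∈ E, ∑ p, f p e := sum_comm
      _ = ∑ e ∈ O, ∑ p, f p e := (sum_subset hO hzero).symm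
      _ ≤ ∑ e ∈ O, cap e := sum_le_sum fun e he => hle e (hO he)
  have hdirect : ∑ p ∈ O, α * cap p ≤ ∑ p ∈ O, ∑ e ∈ E, f p e :=
    sum_le_sum fun p hp => by
      rw [← hval p (hO hp)]
      exact (hf p).le_sum (hE p (hO hp))
  have hdetour : ∑ p ∈ E \ O, 2 * (α * cap p) ≤ ∑ p ∈ E \ O, ∑ e ∈ E, f p e :=
    sum_le_sum fun p hp => by
      obtain ⟨hpE, hpO⟩ := mem_sdiff.mp hp
      rw [← hval p hpE]
      refine (hf p).two_mul_le_sum (hE p hpE) ?_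
      exact (sum_eq_zero_iff_of_nonneg fun q _ => (hf q).1 p).mp (hzero p hpE hpO) p (mem_univ p)
  rw [← sum_sdiff hO] at hupper
  simp only [← mul_sum] at hdirect hdetour
  linarith
end

section
/- Let q ≥ 2 be an integer and α = 1/q. Let V = ℤ/(q+1)ℤ, E = {(s,t) ∈ V×V : s ≠ t}, and for (s,t) ∈ E let η(s,t) be the unique d ∈ {1,…,q} with t = s + d in ℤ/(q+1)ℤ; set cap(s,t) = 1/η(s,t). Let H = {(i, i+1) : i ∈ V} be the Hamiltonian cycle. Then: (a) the scaled matrix α·T_E is routable in H; and (b) every A ⊆ E in which α·T_E is routable satisfies |A| ≥ q+1 = |H|. Hence H is a feasible MMCFS solution of minimum cardinality for (G,cap,α). -/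
open Finset

variable {V : Type*}

/-- On `ZMod (q + 1)` exactly `d.val` residues have representative smaller than `d.val`. -/
theorem card_filter_val_lt (q : ℕ) (d : ZMod (q + 1)) :
    (univ.filter fun x : ZMod (q + 1) => x.val < d.val).card = d.val := by
  refine Eq.trans (congrArg card ?_) (Fin.card_Iio (n := q + 1) d)
  ext x
  exact (Finset.mem_filter_univ x).trans (Finset.mem_Iio (α := Fin (q + 1))).symm

/-- The unit-step path flow on the Hamiltonian cycle from `p.1` to `p.2` of value `c`. -/
def cycleFlow (q : ℕ) (c : ℚ) (p e : ZMod (q + 1) × ZMod (q + 1)) : ℚ :=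
  if e.2 = e.1 + 1 ∧ (e.1 - p.1).val < (p.2 - p.1).val then c else 0

theorem cycleFlow_indicator_sub (q : ℕ) (hq : 1 ≤ q) (c : ℚ) (s t v : ZMod (q + 1))
    (hst : s ≠ t) :
    (if (v - 1 - s).val < (t - s).val then c else 0) -
        (if (v - s).val < (t - s).val then c else 0) =
      (if v = t then c else 0) - (if v = s then c else 0) := by
  have : Fact (1 < q + 1) := ⟨by omega⟩
  have hlt : (t - s).val < q + 1 := ZMod.val_lt _
  have hpos : 0 < (t - s).val := by
    rw [Nat.pos_iff_ne_zero, Ne, ZMod.val_eq_zero, sub_eq_zero]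
    exact hst.symm
  by_cases hvs : v = s
  · subst hvs
    have h2 : ¬ q < (t - v).val := by omega
    simp [ZMod.val_neg_one, h2, hpos, hst]
  · have hx : v - s ≠ 0 := sub_ne_zero.mpr hvs
    have hxpos : 0 < (v - s).val := by
      rwa [Nat.pos_iff_ne_zero, Ne, ZMod.val_eq_zero]
    have h1 : (v - 1 - s).val = (v - s).val - 1 := by
      rw [show v - 1 - s = (v - s) - 1 by ring, ZMod.val_sub, ZMod.val_one]
      rw [ZMod.val_one]
      omega
    have hvt : v = t ↔ (v - s).val = (t - s).val := by
      rw [(ZMod.val_injective (q + 1)).eq_iff, sub_left_inj]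
    simp only [h1, hvt, hvs, if_false]
    split_ifs <;> first | omega | ring

theorem isFlow_cycleFlow (q : ℕ) (hq : 1 ≤ q) (c : ℚ) (hc : 0 ≤ c) (s t : ZMod (q + 1))
    (hst : s = t → c = 0) :
    IsFlow (univ.filter fun p : ZMod (q + 1) × ZMod (q + 1) => p.1 ≠ p.2) s t c
      (cycleFlow q c (s, t)) := by
  have : Fact (1 < q + 1) := ⟨by omega⟩
  refine ⟨fun e => ?_, fun e he => ?_, fun v => ?_⟩
  · unfold cycleFlow
    split_ifs
    exacts [hc, le_rfl]
  · have he' : e.1 = e.2 := by simpa using he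
    simp [cycleFlow, he']
  · rw [Finset.sum_eq_single_of_mem (v - 1, v), Finset.sum_eq_single_of_mem (v, v + 1)]
    · simp only [cycleFlow, sub_add_cancel, true_and]
      by_cases h : s = t
      · simp [hst h]
      · exact cycleFlow_indicator_sub q hq c s t v h
    · simp
    · rintro ⟨a, b⟩ he hne
      obtain rfl : a = v := (Finset.mem_filter.mp he).2
      exact if_neg fun h => hne (Prod.ext rfl h.1)
    · simp
    · rintro ⟨a, b⟩ he hne
      obtain rfl : b = v := (Finset.mem_filter.mp he).2
      exact if_neg fun h => hne (Prod.ext (eq_sub_of_add_eq h.1.symm) rfl)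

/-- The total load on a cycle edge `(i, i + 1)` when each pair at distance `d` sends `c / d`. -/
theorem sum_cycleFlow (q : ℕ) (c : ℚ) (i : ZMod (q + 1)) :
    ∑ p : ZMod (q + 1) × ZMod (q + 1),
      cycleFlow q (c * (1 / ((p.2 - p.1).val : ℚ))) p (i, i + 1) = q * c := by
  calc _ = ∑ s : ZMod (q + 1), ∑ d : ZMod (q + 1),
        if (i - s).val < d.val then c * (1 / (d.val : ℚ)) else 0 := by
        rw [Fintype.sum_prod_type]
        refine Finset.sum_congr rfl fun s _ => ?_
        refine Fintype.sum_equiv (Equiv.subRight s) _ _ fun t => ?_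
        simp [cycleFlow]
    _ = ∑ d : ZMod (q + 1), ∑ x : ZMod (q + 1),
        if x.val < d.val then c * (1 / (d.val : ℚ)) else 0 := by
        rw [Finset.sum_comm]
        refine Finset.sum_congr rfl fun d _ => ?_
        exact Fintype.sum_equiv (Equiv.subLeft i) _ _ fun s => rfl
    _ = ∑ d : ZMod (q + 1), if d ≠ 0 then c else 0 := by
        refine Finset.sum_congr rfl fun d _ => ?_
        rw [← Finset.sum_filter, Finset.sum_const, card_filter_val_lt, nsmul_eq_mul]
        by_cases hd : d = 0
        · simp [hd]
        · have : (d.val : ℚ) ≠ 0 := by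
            rwa [Nat.cast_ne_zero, Ne, ZMod.val_eq_zero]
          rw [if_pos hd]
          field_simp
    _ = q * c := by
        rw [← Finset.sum_filter, Finset.sum_const, Finset.filter_ne' univ (0 : ZMod (q + 1)),
          Finset.card_erase_of_mem (Finset.mem_univ _), Finset.card_univ, ZMod.card,
          Nat.add_sub_cancel, nsmul_eq_mul]

/-- A routing with positive demand out of `s` uses an edge of `A` leaving `s`. -/
theorem Routable.exists_mem_fst_eq {W : Type*} [Fintype W] [DecidableEq W]
    {E : Finset (W × W)} {cap T : W × W → ℚ} {A : Finset (W × W)}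
    (h : Routable E cap T A) {s t : W} (hst : s ≠ t) (hT : 0 < T (s, t)) :
    ∃ e ∈ A, e.1 = s := by
  obtain ⟨f, hf, -, hA⟩ := h
  by_contra! hcon
  obtain ⟨hnonneg, -, hbal⟩ := hf (s, t)
  have hout : ∑ e ∈ E.filter (fun e => e.1 = s), f (s, t) e = 0 := by
    refine Finset.sum_eq_zero fun e he => ?_
    obtain ⟨heE, hes⟩ := Finset.mem_filter.mp he
    have hsum := hA e heE fun heA => hcon e heA hes
    exact (Finset.sum_eq_zero_iff_of_nonneg fun p _ => (hf p).1 e).mp hsum _ (Finset.mem_univ _)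
  have hin : 0 ≤ ∑ e ∈ E.filter (fun e => e.2 = s), f (s, t) e :=
    Finset.sum_nonneg fun e _ => hnonneg e
  have hs := hbal s
  simp only [hout, hst, if_true, if_false] at hs
  linarith

theorem stmt15 (q : ℕ) (hq : 2 ≤ q) (α : ℚ) (hα : α = 1 / (q : ℚ))
    (E : Finset (ZMod (q + 1) × ZMod (q + 1)))
    (hEdef : E = Finset.univ.filter fun p => p.1 ≠ p.2)
    (cap : ZMod (q + 1) × ZMod (q + 1) → ℚ)
    (hcapdef : ∀ p : ZMod (q + 1) × ZMod (q + 1), cap p = 1 / (((p.2 - p.1).val : ℚ)))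
    (H : Finset (ZMod (q + 1) × ZMod (q + 1)))
    (hHdef : H = Finset.univ.image fun i : ZMod (q + 1) => (i, i + 1)) :
    Routable E cap (fun p => α * trafficTE E cap p) H ∧
      (∀ A ⊆ E, Routable E cap (fun p => α * trafficTE E cap p) A → q + 1 ≤ A.card) ∧
      H.card = q + 1 := by
  have : Fact (1 < q + 1) := ⟨by omega⟩
  have hq0 : (0 : ℚ) < q := by exact_mod_cast (by omega : 0 < q)
  have hα0 : 0 < α := by rw [hα]; positivity
  have hT : ∀ p, α * trafficTE E cap p = α * (1 / ((p.2 - p.1).val : ℚ)) := fun p => by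
    by_cases hp : p.1 = p.2
    · simp [trafficTE, hEdef, hp]
    · simp [trafficTE, hEdef, hp, hcapdef]
  simp only [hT]
  refine ⟨⟨fun p => cycleFlow q (α * (1 / ((p.2 - p.1).val : ℚ))) p, fun p => ?_, ?_, ?_⟩,
    fun A _ hA => ?_, ?_⟩
  · rw [hEdef]
    exact isFlow_cycleFlow q (by omega) _ (by positivity) p.1 p.2 fun h => by simp [h]
  · rintro ⟨i, j⟩ -
    by_cases hj : j = i + 1
    · subst hj
      rw [sum_cycleFlow, hcapdef, hα]
      simp [ZMod.val_one, hq0.ne']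
    · rw [Finset.sum_eq_zero fun p _ => by simp [cycleFlow, hj], hcapdef]
      positivity
  · rintro ⟨i, j⟩ - hH
    refine Finset.sum_eq_zero fun p _ => if_neg fun h => hH ?_
    rw [hHdef, Finset.mem_image]
    exact ⟨i, Finset.mem_univ _, Prod.ext rfl h.1.symm⟩
  · have himage : A.image Prod.fst = univ := by
      refine Finset.eq_univ_of_forall fun s => ?_
      obtain ⟨e, he, hes⟩ := hA.exists_mem_fst_eq (s := s) (t := s + 1) (by simp)
        (by simpa [ZMod.val_one] using hα0)
      exact Finset.mem_image.mpr ⟨e, he, hes⟩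
    calc q + 1 = (A.image Prod.fst).card := by rw [himage, Finset.card_univ, ZMod.card]
      _ ≤ A.card := Finset.card_image_le
  · rw [hHdef, Finset.card_image_of_injective _ fun a b h => congrArg Prod.fst h,
      Finset.card_univ, ZMod.card]
end

section
/- For every rational α with 1/2 < α < 1 and every rational ε > 0, there exist a digraph G=(V,E) with positive capacities cap and a basic optimal solution (x*, f*) of the LP feasible region P for (G,cap,α) such that |{e ∈ E : x*(e) > 0}| ≥ (2 − ε)·m, where m is the minimum cardinality of a set A ⊆ E in which the scaled matrix α·T_E is routable. -/
open Finset

variable {V : Type*}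

/-- The LP feasible region `P` for `(G, cap, α)`: pairs `(x, f)` where each commodity
`k ∈ E` routes a flow of value `α · cap k` and the total flow on each edge `e` is at
most `x e · cap e`, with `0 ≤ x e ≤ 1`. Coordinates outside `E` are fixed to `0`. -/
def LPRegion [Fintype V] [DecidableEq V] (E : Finset (V × V)) (cap : V × V → ℚ)
    (α : ℚ) : Set ((V × V → ℚ) × (V × V → V × V → ℚ)) :=
  {p | (∀ k, k ∉ E → p.2 k = 0) ∧
       (∀ k ∈ E, IsFlow E k.1 k.2 (α * cap k) (p.2 k)) ∧
       (∀ e ∈ E, (∑ k ∈ E, p.2 k e) ≤ p.1 e * cap e) ∧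
       (∀ e ∈ E, 0 ≤ p.1 e ∧ p.1 e ≤ 1) ∧
       (∀ e, e ∉ E → p.1 e = 0)}

/-- A basic optimal solution of the LP: an extreme point of the feasible region
minimizing `∑ e ∈ E, x e`. -/
def BasicOptimal [Fintype V] [DecidableEq V] (E : Finset (V × V)) (cap : V × V → ℚ)
    (α : ℚ) (p : (V × V → ℚ) × (V × V → V × V → ℚ)) : Prop :=
  p ∈ Set.extremePoints ℚ (LPRegion E cap α) ∧
    ∀ q ∈ LPRegion E cap α, (∑ e ∈ E, p.1 e) ≤ ∑ e ∈ E, q.1 e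

namespace LPGap

section Flow

variable [Fintype V] [DecidableEq V] {E : Finset (V × V)}

theorem isFlow_zero (s t : V) : IsFlow E s t 0 0 := by
  refine ⟨fun _ => le_rfl, fun _ _ => rfl, fun v => ?_⟩
  simp

theorem isFlow_refl (s : V) (d : ℚ) : IsFlow E s s d 0 := by
  refine ⟨fun _ => le_rfl, fun _ _ => rfl, fun v => ?_⟩
  simp

theorem isFlow_single {e : V × V} (he : e ∈ E) {d : ℚ} (hd : 0 ≤ d) :
    IsFlow E e.1 e.2 d (fun e' => if e' = e then d else 0) := by
  refine ⟨fun e' => ite_nonneg hd le_rfl, fun e' h => if_neg ?_, fun v => ?_⟩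
  · rintro rfl
    exact h he
  · simp [Finset.mem_filter, he, eq_comm]

theorem isFlow_trans {s t u : V} {d : ℚ} {f g : V × V → ℚ} (hf : IsFlow E s t d f)
    (hg : IsFlow E t u d g) : IsFlow E s u d (fun e => f e + g e) := by
  obtain ⟨f0, f1, f2⟩ := hf
  obtain ⟨g0, g1, g2⟩ := hg
  refine ⟨fun e => add_nonneg (f0 e) (g0 e), fun e h => by simp [f1 e h, g1 e h], fun v => ?_⟩
  simp only [Finset.sum_add_distrib]
  linarith [f2 v, g2 v]

theorem isFlow_add {s t : V} {d d' : ℚ} {f g : V × V → ℚ} (hf : IsFlow E s t d f)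
    (hg : IsFlow E s t d' g) : IsFlow E s t (d + d') (fun e => f e + g e) := by
  obtain ⟨f0, f1, f2⟩ := hf
  obtain ⟨g0, g1, g2⟩ := hg
  refine ⟨fun e => add_nonneg (f0 e) (g0 e), fun e h => by simp [f1 e h, g1 e h], fun v => ?_⟩
  simp only [Finset.sum_add_distrib]
  have h1 := f2 v
  have h2 := g2 v
  split_ifs at * <;> linarith

/-- Summing potential differences along a flow gives the potential difference of its ends. -/
theorem sum_potential_of_isFlow {s t : V} {d : ℚ} {f : V × V → ℚ} (hf : IsFlow E s t d f)
    (φ : V → ℚ) : ∑ e ∈ E, (φ e.2 - φ e.1) * f e = d * (φ t - φ s) := by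
  have h : ∑ v, φ v * ((∑ e ∈ E.filter (fun e => e.2 = v), f e) -
      ∑ e ∈ E.filter (fun e => e.1 = v), f e) = ∑ e ∈ E, (φ e.2 - φ e.1) * f e := by
    simp only [mul_sub, Finset.sum_sub_distrib, sub_mul, Finset.mul_sum]
    congr 1
    · rw [← Finset.sum_fiberwise E (fun e => e.2)]
      refine Finset.sum_congr rfl fun v _ => Finset.sum_congr rfl fun e he => ?_
      rw [(Finset.mem_filter.1 he).2]
    · rw [← Finset.sum_fiberwise E (fun e => e.1)]
      refine Finset.sum_congr rfl fun v _ => Finset.sum_congr rfl fun e he => ?_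
      rw [(Finset.mem_filter.1 he).2]
  rw [← h, Finset.sum_congr rfl fun v _ => by rw [hf.2.2 v]]
  simp only [mul_sub, Finset.sum_sub_distrib, mul_ite, mul_zero, Finset.sum_ite_eq',
    Finset.mem_univ, if_true]
  ring

end Flow

/-- The `i`-th vertex of the path `0 → 1 → ⋯ → N`. -/
def vtx (N i : ℕ) : Fin (N + 1) := Fin.ofNat (N + 1) i

def stepEdge (N i : ℕ) : Fin (N + 1) × Fin (N + 1) := (vtx N i, vtx N (i + 1))

def skipEdge (N i : ℕ) : Fin (N + 1) × Fin (N + 1) := (vtx N i, vtx N (i + 2))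

def longEdge (N : ℕ) : Fin (N + 1) × Fin (N + 1) := (vtx N 0, vtx N N)

/-- A path with all shortcuts of length two and one shortcut between its ends. -/
def edges (N : ℕ) : Finset (Fin (N + 1) × Fin (N + 1)) :=
  (range N).image (stepEdge N) ∪ ((range (N - 1)).image (skipEdge N) ∪ {longEdge N})

theorem val_vtx {N i : ℕ} (h : i ≤ N) : (vtx N i).val = i := by
  simp only [vtx, Fin.val_ofNat]
  exact Nat.mod_eq_of_lt (by omega)

section Edges

variable {N : ℕ}

theorem stepEdge_vals {i : ℕ} (h : i < N) :
    (stepEdge N i).1.val = i ∧ (stepEdge N i).2.val = i + 1 :=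
  ⟨val_vtx (by omega), val_vtx (by omega)⟩

theorem skipEdge_vals {i : ℕ} (h : i < N - 1) :
    (skipEdge N i).1.val = i ∧ (skipEdge N i).2.val = i + 2 :=
  ⟨val_vtx (by omega), val_vtx (by omega)⟩

theorem longEdge_vals : (longEdge N).1.val = 0 ∧ (longEdge N).2.val = N :=
  ⟨val_vtx (by omega), val_vtx (by omega)⟩

theorem edge_ext_iff {n : ℕ} {e e' : Fin n × Fin n} :
    e = e' ↔ e.1.val = e'.1.val ∧ e.2.val = e'.2.val := by
  rw [Prod.ext_iff, Fin.ext_iff, Fin.ext_iff]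

theorem mem_edges {e : Fin (N + 1) × Fin (N + 1)} : e ∈ edges N ↔
    (∃ i < N, e = stepEdge N i) ∨ (∃ i < N - 1, e = skipEdge N i) ∨ e = longEdge N := by
  simp only [edges, mem_union, mem_image, mem_range, mem_singleton, eq_comm]

theorem stepEdge_mem {i : ℕ} (h : i < N) : stepEdge N i ∈ edges N :=
  mem_edges.2 (Or.inl ⟨i, h, rfl⟩)

theorem skipEdge_mem {i : ℕ} (h : i < N - 1) : skipEdge N i ∈ edges N :=
  mem_edges.2 (Or.inr (Or.inl ⟨i, h, rfl⟩))

theorem longEdge_mem : longEdge N ∈ edges N :=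
  mem_edges.2 (Or.inr (Or.inr rfl))

theorem forall_edges {P : Fin (N + 1) × Fin (N + 1) → Prop} (h₁ : ∀ i < N, P (stepEdge N i))
    (h₂ : ∀ i < N - 1, P (skipEdge N i)) (h₃ : P (longEdge N)) : ∀ e ∈ edges N, P e := by
  intro e he
  rcases mem_edges.1 he with ⟨i, hi, rfl⟩ | ⟨i, hi, rfl⟩ | rfl
  exacts [h₁ i hi, h₂ i hi, h₃]

theorem lt_of_mem_edges (hN : 3 ≤ N) : ∀ e ∈ edges N, e.1.val < e.2.val := by
  refine forall_edges (fun i hi => ?_) (fun i hi => ?_) ?_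
  · have := stepEdge_vals hi
    omega
  · have := skipEdge_vals hi
    omega
  · have := longEdge_vals (N := N)
    omega

theorem sum_edges (hN : 3 ≤ N) (g : Fin (N + 1) × Fin (N + 1) → ℚ) :
    ∑ e ∈ edges N, g e = ∑ i ∈ range N, g (stepEdge N i) +
      (∑ i ∈ range (N - 1), g (skipEdge N i) + g (longEdge N)) := by
  rw [edges, sum_union, sum_union, sum_image, sum_image, sum_singleton]
  · intro i hi j hj h
    have := skipEdge_vals (mem_range.1 hi)
    have := skipEdge_vals (mem_range.1 hj)
    rw [edge_ext_iff] at h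
    omega
  · intro i hi j hj h
    have := stepEdge_vals (mem_range.1 hi)
    have := stepEdge_vals (mem_range.1 hj)
    rw [edge_ext_iff] at h
    omega
  · rw [disjoint_left]
    intro e he he'
    obtain ⟨i, hi, rfl⟩ := mem_image.1 he
    have := skipEdge_vals (mem_range.1 hi)
    have h := mem_singleton.1 he'
    have := longEdge_vals (N := N)
    rw [edge_ext_iff] at h
    omega
  · rw [disjoint_left]
    intro e he he'
    obtain ⟨i, hi, rfl⟩ := mem_image.1 he
    have := stepEdge_vals (mem_range.1 hi)
    rcases mem_union.1 he' with h | h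
    · obtain ⟨j, hj, h⟩ := mem_image.1 h
      have := skipEdge_vals (mem_range.1 hj)
      rw [edge_ext_iff] at h
      omega
    · have h := mem_singleton.1 h
      have := longEdge_vals (N := N)
      rw [edge_ext_iff] at h
      omega

/-- The flow of value `d` along the steps of the path from `a` to `b`. -/
def chain (N a b : ℕ) (d : ℚ) (e : Fin (N + 1) × Fin (N + 1)) : ℚ :=
  if e.2.val = e.1.val + 1 ∧ a ≤ e.1.val ∧ e.1.val < b then d else 0

theorem isFlow_chain (a : ℕ) {b : ℕ} (hab : a ≤ b) (hb : b ≤ N) {d : ℚ} (hd : 0 ≤ d) :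
    IsFlow (edges N) (vtx N a) (vtx N b) d (chain N a b d) := by
  induction b, hab using Nat.le_induction with
  | base =>
    convert isFlow_refl (E := edges N) (vtx N a) d using 1
    ext e
    simp only [chain, Pi.zero_apply, ite_eq_right_iff]
    omega
  | succ b hab ih =>
    have h := isFlow_trans (ih (by omega)) (isFlow_single (stepEdge_mem (i := b) (by omega)) hd)
    convert (show IsFlow (edges N) (vtx N a) (vtx N (b + 1)) d _ from h) using 1
    ext e
    have h1 := stepEdge_vals (N := N) (i := b) (by omega)
    simp only [chain, edge_ext_iff, h1]
    split_ifs <;> first | omega | simp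

/-- Commodity `k` sends `y k` units along the edge `k`, and the rest along the path. -/
def routing (N : ℕ) (D y : Fin (N + 1) × Fin (N + 1) → ℚ) (k e : Fin (N + 1) × Fin (N + 1)) : ℚ :=
  if k ∈ edges N then (if e = k then y k else 0) + chain N k.1.val k.2.val (D k - y k) e else 0

theorem isFlow_routing (hN : 3 ≤ N) {D y : Fin (N + 1) × Fin (N + 1) → ℚ}
    {k : Fin (N + 1) × Fin (N + 1)} (hk : k ∈ edges N) (h0 : 0 ≤ y k) (h1 : y k ≤ D k) :
    IsFlow (edges N) k.1 k.2 (D k) (routing N D y k) := by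
  have h := isFlow_add (isFlow_single hk h0) (by
    simpa [vtx] using isFlow_chain (N := N) k.1.val (lt_of_mem_edges hN k hk).le
      (Nat.lt_succ_iff.1 k.2.isLt) (sub_nonneg.2 h1))
  convert h using 1
  · ring
  · ext e
    simp [routing, hk]

/-- A flow for `k` supported on `k` and on the path is determined by its value at `k`. -/
theorem eq_routing_of_support {D : Fin (N + 1) × Fin (N + 1) → ℚ}
    {k : Fin (N + 1) × Fin (N + 1)} (hk : k ∈ edges N) {g : Fin (N + 1) × Fin (N + 1) → ℚ}
    (hg : IsFlow (edges N) k.1 k.2 (D k) g)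
    (hs : ∀ e, e ≠ k → ¬ (e.2.val = e.1.val + 1 ∧ k.1.val ≤ e.1.val ∧ e.1.val < k.2.val) →
      g e = 0) (y : Fin (N + 1) × Fin (N + 1) → ℚ) (hy : y k = g k) :
    g = routing N D y k := by
  ext e
  simp only [routing, hk, if_true, chain]
  split_ifs with he hc hc
  · subst he
    rw [hy]
    have h := sum_potential_of_isFlow hg (fun v => if v.val ≤ e.1.val then 0 else 1)
    rw [Finset.sum_eq_single_of_mem e hk] at h
    · have h1 : ¬ e.2.val ≤ e.1.val := by omega
      simp only [h1, le_refl, if_true, if_false] at h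
      linarith
    · intro e' _ he'
      by_cases h2 : e'.2.val = e'.1.val + 1 ∧ e.1.val ≤ e'.1.val ∧ e'.1.val < e.2.val
      · exact absurd (edge_ext_iff.2 (by omega)) he'
      · rw [hs e' he' h2, mul_zero]
  · subst he
    simp [hy]
  · have h := sum_potential_of_isFlow hg (fun v => if v.val ≤ e.1.val then 0 else 1)
    have heE : e ∈ edges N := by
      have := e.2.isLt
      have h1 := stepEdge_vals (N := N) (i := e.1.val) (by omega)
      have h2 : e = stepEdge N e.1.val := edge_ext_iff.2 (by omega)
      exact h2 ▸ stepEdge_mem (by omega)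
    rw [← Finset.sum_subset (s₁ := {e, k}), Finset.sum_pair he] at h
    · have h1 : ¬ e.2.val ≤ e.1.val := by omega
      have h2 : ¬ k.2.val ≤ e.1.val := by omega
      simp only [h1, h2, hc.2.1, le_refl, if_true, if_false] at h
      linarith
    · intro e' h'
      rcases mem_insert.1 h' with rfl | h'
      · exact heE
      · rw [mem_singleton.1 h']
        exact hk
    · intro e' _ h'
      simp only [mem_insert, mem_singleton, not_or] at h'
      by_cases h2 : e'.2.val = e'.1.val + 1 ∧ k.1.val ≤ e'.1.val ∧ e'.1.val < k.2.val
      · have h3 : ¬ (e'.1.val = e.1.val ∧ e'.2.val = e.2.val) := fun h => h'.1 (edge_ext_iff.2 h)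
        have h4 : (e'.2.val ≤ e.1.val) ↔ (e'.1.val ≤ e.1.val) := by omega
        simp [h4]
      · rw [hs e' h'.2 h2, mul_zero]
  · rw [hs e he hc, add_zero]

theorem sum_routing_step (hN : 3 ≤ N) (D y : Fin (N + 1) × Fin (N + 1) → ℚ) {j : ℕ} (hj : j < N) :
    ∑ k ∈ edges N, routing N D y k (stepEdge N j) = D (stepEdge N j) +
      ((∑ i ∈ range (N - 1), if i ≤ j ∧ j < i + 2 then D (skipEdge N i) - y (skipEdge N i) else 0) +
        (D (longEdge N) - y (longEdge N))) := by
  have hj' := stepEdge_vals hj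
  rw [sum_edges hN]
  congr 1
  · rw [Finset.sum_eq_single_of_mem j (mem_range.2 hj)]
    · simp [routing, stepEdge_mem hj, chain, hj']
    · intro i hi hij
      have hi' := stepEdge_vals (mem_range.1 hi)
      simp only [routing, stepEdge_mem (mem_range.1 hi), chain, hj', hi', edge_ext_iff, true_and]
      split_ifs <;> first | omega | simp
  · congr 1
    · refine Finset.sum_congr rfl fun i hi => ?_
      have hi' := skipEdge_vals (mem_range.1 hi)
      simp only [routing, skipEdge_mem (mem_range.1 hi), chain, hj', hi', edge_ext_iff, true_and]
      split_ifs <;> first | omega | simp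
    · have hi' := longEdge_vals (N := N)
      simp only [routing, longEdge_mem, chain, hj', hi', edge_ext_iff, true_and]
      split_ifs <;> first | omega | simp

theorem sum_routing_of_ne (D y : Fin (N + 1) × Fin (N + 1) → ℚ)
    {e : Fin (N + 1) × Fin (N + 1)} (he : e ∈ edges N) (h : e.2.val ≠ e.1.val + 1) :
    ∑ k ∈ edges N, routing N D y k e = y e := by
  rw [Finset.sum_eq_single_of_mem e he]
  · simp [routing, he, chain, h]
  · intro k hk hne
    simp [routing, chain, h, hne.symm]

theorem sum_cover_eq {j : ℕ} (h0 : 0 < j) (hj : j < N - 1) (r : ℕ → ℚ) :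
    (∑ i ∈ range (N - 1), if i ≤ j ∧ j < i + 2 then r i else 0) = r (j - 1) + r j := by
  rw [← Finset.sum_filter, ← Finset.sum_pair (show j - 1 ≠ j by omega)]
  refine Finset.sum_congr ?_ fun _ _ => rfl
  ext i
  simp only [mem_filter, mem_range, mem_insert, mem_singleton]
  omega

theorem sum_cover_le {j : ℕ} {r : ℕ → ℚ} {R : ℚ} (hr : ∀ i < N - 1, r i ≤ R) (hR : 0 ≤ R) :
    (∑ i ∈ range (N - 1), if i ≤ j ∧ j < i + 2 then r i else 0) ≤ 2 * R := by
  rw [← Finset.sum_filter]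
  refine (Finset.sum_le_card_nsmul _ _ R fun i hi =>
    hr i (mem_range.1 (mem_filter.1 hi).1)).trans ?_
  rw [nsmul_eq_mul]
  have h : ((range (N - 1)).filter fun i => i ≤ j ∧ j < i + 2).card ≤ 2 := by
    refine (card_le_card (t := {j - 1, j}) fun i hi => ?_).trans card_le_two
    simp only [mem_filter, mem_insert, mem_singleton] at hi ⊢
    omega
  have h' : (((range (N - 1)).filter fun i => i ≤ j ∧ j < i + 2).card : ℚ) ≤ 2 := by
    exact_mod_cast h
  exact mul_le_mul_of_nonneg_right h' hR

theorem sum_cover_end_le (hN : 3 ≤ N) {j : ℕ} (hj : j = 0 ∨ j = N - 1) {r : ℕ → ℚ} {R : ℚ}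
    (hr : ∀ i < N - 1, r i ≤ R) :
    (∑ i ∈ range (N - 1), if i ≤ j ∧ j < i + 2 then r i else 0) ≤ R := by
  rw [Finset.sum_eq_single_of_mem (if j = 0 then 0 else N - 2)]
  · split_ifs <;> first | omega | exact hr _ (by omega)
  · rw [mem_range]
    split_ifs <;> omega
  · intro i hi hne
    rw [mem_range] at hi
    refine if_neg ?_
    split_ifs at hne <;> omega

end Edges

/-- The parameters of the instance: `c` is the capacity of a shortcut of length two which
saturates the path, and `η` is a small overflow. -/
structure Admissible (N : ℕ) (α c η : ℚ) : Prop where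
  three_le : 3 ≤ N
  odd : Odd N
  α_pos : 0 < α
  α_lt : α < 1
  saturate : 2 * (α * c) = 1 - α
  c_pos : 0 < c
  c_le : 2 * c ≤ 1
  η_pos : 0 < η
  η_le : 2 * η * N ≤ α * c

/-- The capacities. -/
def capacity (N : ℕ) (α c η : ℚ) (e : Fin (N + 1) × Fin (N + 1)) : ℚ :=
  if e.2.val = e.1.val + 1 then 1
  else if e.2.val = e.1.val + 2 then (if e.1.val = 0 then c - η / α else c)
  else 2 * η / α

/-- The amount which each commodity sends directly in the basic optimal solution. -/
def direct (N : ℕ) (α η : ℚ) (e : Fin (N + 1) × Fin (N + 1)) : ℚ :=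
  if e.2.val = e.1.val + 1 then α
  else if e.2.val = e.1.val + 2 then (if e.1.val = 0 then 0 else η)
  else 0

/-- The demands. -/
def demand (N : ℕ) (α c η : ℚ) (e : Fin (N + 1) × Fin (N + 1)) : ℚ := α * capacity N α c η e

/-- The load on `e` when commodity `k` sends `y k` directly. -/
def load (N : ℕ) (D y : Fin (N + 1) × Fin (N + 1) → ℚ) (e : Fin (N + 1) × Fin (N + 1)) : ℚ :=
  ∑ k ∈ edges N, routing N D y k e

/-- The price of the `j`-th step of the path. -/
def price (c : ℚ) (j : ℕ) : ℚ := if Even j then 1 else 1 / c - 1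

def potential (N : ℕ) (c : ℚ) (v : Fin (N + 1)) : ℚ := ∑ j ∈ range v.val, price c j

/-- The dual variable of the constraint `x e ≤ 1`. -/
def penalty (N : ℕ) (c : ℚ) (e : Fin (N + 1) × Fin (N + 1)) : ℚ :=
  if e.2.val = e.1.val + 1 then price c e.1.val - 1 else 0

section Instance

variable {N : ℕ} {α c η : ℚ}

theorem capacity_step {i : ℕ} (hi : i < N) : capacity N α c η (stepEdge N i) = 1 := by
  simp [capacity, stepEdge_vals hi]

theorem capacity_skip {i : ℕ} (hi : i < N - 1) :
    capacity N α c η (skipEdge N i) = if i = 0 then c - η / α else c := by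
  simp [capacity, skipEdge_vals hi]

theorem capacity_long (hN : 3 ≤ N) : capacity N α c η (longEdge N) = 2 * η / α := by
  have h1 : N ≠ 1 := by omega
  have h2 : N ≠ 2 := by omega
  simp [capacity, longEdge_vals, h1, h2]

theorem direct_step {i : ℕ} (hi : i < N) : direct N α η (stepEdge N i) = α := by
  simp [direct, stepEdge_vals hi]

theorem direct_skip {i : ℕ} (hi : i < N - 1) :
    direct N α η (skipEdge N i) = if i = 0 then 0 else η := by
  simp [direct, skipEdge_vals hi]

theorem direct_long (hN : 3 ≤ N) : direct N α η (longEdge N) = 0 := by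
  have h1 : N ≠ 1 := by omega
  have h2 : N ≠ 2 := by omega
  simp [direct, longEdge_vals, h1, h2]

theorem load_skip {i : ℕ} (hi : i < N - 1) (D y : Fin (N + 1) × Fin (N + 1) → ℚ) :
    load N D y (skipEdge N i) = y (skipEdge N i) := by
  refine sum_routing_of_ne D y (skipEdge_mem hi) ?_
  have := skipEdge_vals hi
  omega

theorem load_long (hN : 3 ≤ N) (D y : Fin (N + 1) × Fin (N + 1) → ℚ) :
    load N D y (longEdge N) = y (longEdge N) := by
  refine sum_routing_of_ne D y longEdge_mem ?_
  have := longEdge_vals (N := N)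
  omega

theorem routing_step {i : ℕ} (hi : i < N) (D y y' : Fin (N + 1) × Fin (N + 1) → ℚ) :
    routing N D y (stepEdge N i) = routing N D y' (stepEdge N i) := by
  ext e
  have hi' := stepEdge_vals hi
  simp only [routing, stepEdge_mem hi, chain, hi', edge_ext_iff, if_true]
  split_ifs <;> first | omega | simp

theorem demand_step {i : ℕ} (hi : i < N) : demand N α c η (stepEdge N i) = α := by
  rw [demand, capacity_step hi, mul_one]

theorem potential_step {i : ℕ} (hi : i < N) :
    potential N c (stepEdge N i).2 - potential N c (stepEdge N i).1 = price c i := by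
  simp [potential, stepEdge_vals hi, sum_range_succ]

theorem potential_skip {i : ℕ} (hi : i < N - 1) :
    potential N c (skipEdge N i).2 - potential N c (skipEdge N i).1 = 1 / c := by
  have h1 : price c i + price c (i + 1) = 1 / c := by
    by_cases hi : Even i <;> simp [price, hi, Nat.even_add_one]
  simp only [potential, skipEdge_vals hi, sum_range_succ]
  linarith

theorem sum_potential_mul {p : (Fin (N + 1) × Fin (N + 1) → ℚ) ×
      (Fin (N + 1) × Fin (N + 1) → Fin (N + 1) × Fin (N + 1) → ℚ)}
    (hp : p ∈ LPRegion (edges N) (capacity N α c η) α) :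
    ∑ e ∈ edges N, (potential N c e.2 - potential N c e.1) * ∑ k ∈ edges N, p.2 k e =
      ∑ k ∈ edges N, demand N α c η k * (potential N c k.2 - potential N c k.1) := by
  simp only [mul_sum]
  rw [sum_comm]
  exact sum_congr rfl fun k hk => sum_potential_of_isFlow (hp.2.1 k hk) _

namespace Admissible

variable (h : Admissible N α c η)
include h

theorem η_lt : 2 * η < α * c := by
  have h1 : (3 : ℚ) ≤ N := by exact_mod_cast h.three_le
  nlinarith [h.η_le, h.η_pos]

theorem demand_skip {i : ℕ} (hi : i < N - 1) :
    demand N α c η (skipEdge N i) = if i = 0 then α * c - η else α * c := by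
  have := h.α_pos.ne'
  rw [demand, capacity_skip hi]
  split_ifs
  · field_simp
  · rfl

theorem demand_long : demand N α c η (longEdge N) = 2 * η := by
  have := h.α_pos.ne'
  rw [demand, capacity_long h.three_le]
  field_simp

theorem residual_skip {i : ℕ} (hi : i < N - 1) :
    demand N α c η (skipEdge N i) - direct N α η (skipEdge N i) = α * c - η := by
  rw [h.demand_skip hi, direct_skip hi]
  split_ifs <;> ring

theorem capacity_pos : ∀ e ∈ edges N, 0 < capacity N α c η e := by
  have h1 := h.η_lt
  have h2 := h.α_pos
  have h3 := h.η_pos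
  refine forall_edges (fun i hi => ?_) (fun i hi => ?_) ?_
  · rw [capacity_step hi]
    exact one_pos
  · rw [capacity_skip hi]
    split_ifs
    · rw [sub_pos, div_lt_iff₀ h2]
      linarith
    · exact h.c_pos
  · rw [capacity_long h.three_le]
    positivity

theorem direct_nonneg : ∀ e ∈ edges N, 0 ≤ direct N α η e := by
  refine forall_edges (fun i hi => ?_) (fun i hi => ?_) ?_
  · rw [direct_step hi]
    exact h.α_pos.le
  · rw [direct_skip hi]
    exact ite_nonneg le_rfl h.η_pos.le
  · rw [direct_long h.three_le]

theorem direct_le : ∀ e ∈ edges N, direct N α η e ≤ demand N α c η e := by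
  refine forall_edges (fun i hi => ?_) (fun i hi => ?_) ?_
  · rw [direct_step hi, demand_step hi]
  · linarith [h.residual_skip hi, h.η_lt, h.η_pos]
  · rw [direct_long h.three_le, h.demand_long]
    linarith [h.η_pos]

theorem load_step (y : Fin (N + 1) × Fin (N + 1) → ℚ) {j : ℕ} (hj : j < N) :
    load N (demand N α c η) y (stepEdge N j) = α +
      ((∑ i ∈ range (N - 1), if i ≤ j ∧ j < i + 2 then
        demand N α c η (skipEdge N i) - y (skipEdge N i) else 0) +
        (2 * η - y (longEdge N))) := by
  rw [load, sum_routing_step h.three_le _ _ hj, demand_step hj, h.demand_long]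

theorem load_direct_inner {j : ℕ} (h0 : 0 < j) (hj : j < N - 1) :
    load N (demand N α c η) (direct N α η) (stepEdge N j) = 1 := by
  rw [h.load_step _ (by omega),
    sum_cover_eq h0 hj fun i => demand N α c η (skipEdge N i) - direct N α η (skipEdge N i),
    h.residual_skip hj, h.residual_skip (by omega), direct_long h.three_le]
  linarith [h.saturate]

theorem load_direct_le {j : ℕ} (hj : j < N) :
    load N (demand N α c η) (direct N α η) (stepEdge N j) ≤ 1 := by
  by_cases hj' : j = 0 ∨ j = N - 1
  · have h1 := sum_cover_end_le h.three_le hj' fun i hi => (h.residual_skip hi).le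
    rw [h.load_step _ hj, direct_long h.three_le]
    linarith [h.saturate, h.η_lt, h.η_pos]
  · exact (h.load_direct_inner (by omega) (by omega)).le

theorem load_direct_pos {j : ℕ} (hj : j < N) :
    0 < load N (demand N α c η) (direct N α η) (stepEdge N j) := by
  rw [h.load_step _ hj, direct_long h.three_le]
  have h1 : 0 ≤ ∑ i ∈ range (N - 1), if i ≤ j ∧ j < i + 2 then
      demand N α c η (skipEdge N i) - direct N α η (skipEdge N i) else 0 :=
    sum_nonneg fun i hi => ite_nonneg
      (sub_nonneg.2 (h.direct_le _ (skipEdge_mem (mem_range.1 hi)))) le_rfl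
  linarith [h.α_pos, h.η_pos]

/-! ### The solution is optimal -/

theorem one_le_price (j : ℕ) : 1 ≤ price c j := by
  rw [price]
  split_ifs
  · exact le_rfl
  · rw [le_sub_iff_add_le, le_div_iff₀ h.c_pos]
    linarith [h.c_le]

theorem price_le (j : ℕ) : price c j ≤ 1 / c := by
  rw [price]
  split_ifs
  · rw [le_div_iff₀ h.c_pos]
    linarith [h.c_le, h.c_pos]
  · linarith

theorem potential_long :
    potential N c (longEdge N).2 - potential N c (longEdge N).1 ≤ α / (2 * η) := by
  simp only [potential, longEdge_vals, range_zero, sum_empty, sub_zero]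
  refine (sum_le_card_nsmul _ _ _ fun j _ => h.price_le j).trans ?_
  rw [card_range, nsmul_eq_mul, mul_one_div, div_le_div_iff₀ h.c_pos (by linarith [h.η_pos])]
  linarith [h.η_le]

theorem potential_mul_sub_penalty_le : ∀ e ∈ edges N, ∀ l x : ℚ, 0 ≤ l →
    l ≤ x * capacity N α c η e → x ≤ 1 →
    (potential N c e.2 - potential N c e.1) * l - penalty N c e ≤ x := by
  have hα := h.α_pos
  have hη := h.η_pos
  refine forall_edges (fun i hi l x hl hlx hx => ?_) (fun i hi l x hl hlx hx => ?_)
    (fun l x hl hlx hx => ?_)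
  · have h1 := stepEdge_vals hi
    have h2 := h.one_le_price i
    rw [potential_step hi, penalty, if_pos (by omega), h1.1]
    rw [capacity_step hi] at hlx
    nlinarith
  · have h1 := skipEdge_vals hi
    rw [potential_skip hi, penalty, if_neg (by omega), sub_zero, one_div_mul_eq_div,
      div_le_iff₀ h.c_pos]
    have h3 : capacity N α c η (skipEdge N i) ≤ c := by
      rw [capacity_skip hi]
      split_ifs
      · have : 0 < η / α := by positivity
        linarith
      · exact le_rfl
    have h4 := h.capacity_pos _ (skipEdge_mem hi)
    have h5 : 0 ≤ x := by
      by_contra! hx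
      nlinarith
    exact hlx.trans (mul_le_mul_of_nonneg_left h3 h5)
  · have h1 := longEdge_vals (N := N)
    have h2 := h.three_le
    rw [penalty, if_neg (by omega), sub_zero]
    refine (mul_le_mul_of_nonneg_right h.potential_long hl).trans ?_
    rw [capacity_long h2] at hlx
    calc α / (2 * η) * l ≤ α / (2 * η) * (x * (2 * η / α)) :=
          mul_le_mul_of_nonneg_left hlx (by positivity)
      _ = x := by field_simp

theorem potential_mul_direct : ∀ e ∈ edges N,
    (potential N c e.2 - potential N c e.1) * load N (demand N α c η) (direct N α η) e -
      penalty N c e = load N (demand N α c η) (direct N α η) e / capacity N α c η e := by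
  refine forall_edges (fun i hi => ?_) (fun i hi => ?_) ?_
  · have h1 := stepEdge_vals hi
    rw [potential_step hi, penalty, if_pos (by omega), h1.1, capacity_step hi, div_one]
    by_cases h2 : Even i
    · simp [price, h2]
    · obtain ⟨a, ha⟩ := h.odd
      obtain ⟨b, hb⟩ := Nat.not_even_iff_odd.1 h2
      rw [h.load_direct_inner (by omega) (by omega)]
      ring
  · have h1 := skipEdge_vals hi
    rw [potential_skip hi, penalty, if_neg (by omega), load_skip hi, direct_skip hi,
      capacity_skip hi]
    split_ifs
    · simp
    · ring
  · have h1 := longEdge_vals (N := N)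
    have h2 := h.three_le
    rw [penalty, if_neg (by omega), load_long h2, direct_long h2]
    simp

end Admissible

/-- The edge weights of the basic optimal solution. -/
def weight (N : ℕ) (α c η : ℚ) (e : Fin (N + 1) × Fin (N + 1)) : ℚ :=
  if e ∈ edges N then load N (demand N α c η) (direct N α η) e / capacity N α c η e else 0

namespace Admissible

variable (h : Admissible N α c η)
include h

theorem solution_mem : (weight N α c η, routing N (demand N α c η) (direct N α η)) ∈
    LPRegion (edges N) (capacity N α c η) α := by
  have hα := h.α_pos
  have hη := h.η_pos
  refine ⟨fun k hk => ?_, fun k hk => isFlow_routing h.three_le hk (h.direct_nonneg k hk)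
    (h.direct_le k hk), fun e he => ?_, ?_, fun e he => if_neg he⟩
  · ext e
    simp [routing, hk]
  · simp only [weight, he, if_true]
    rw [div_mul_cancel₀ _ (h.capacity_pos e he).ne']
    exact le_rfl
  · refine forall_edges (fun i hi => ?_) (fun i hi => ?_) ?_
    · simp only [weight, stepEdge_mem hi, if_true, capacity_step hi, div_one]
      exact ⟨(h.load_direct_pos hi).le, h.load_direct_le hi⟩
    · have h1 := h.capacity_pos _ (skipEdge_mem hi)
      simp only [weight, skipEdge_mem hi, if_true, load_skip hi]
      refine ⟨div_nonneg (h.direct_nonneg _ (skipEdge_mem hi)) h1.le, ?_⟩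
      rw [div_le_one h1, direct_skip hi, capacity_skip hi]
      rw [capacity_skip hi] at h1
      split_ifs at h1 ⊢
      · exact h1.le
      · nlinarith [h.η_lt, h.α_lt]
    · simp [weight, longEdge_mem, load_long h.three_le, direct_long h.three_le]

theorem sum_weight_le {q : (Fin (N + 1) × Fin (N + 1) → ℚ) ×
      (Fin (N + 1) × Fin (N + 1) → Fin (N + 1) × Fin (N + 1) → ℚ)}
    (hq : q ∈ LPRegion (edges N) (capacity N α c η) α) :
    ∑ e ∈ edges N, weight N α c η e ≤ ∑ e ∈ edges N, q.1 e := by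
  have h1 := sum_potential_mul h.solution_mem
  have h2 := sum_potential_mul hq
  calc ∑ e ∈ edges N, weight N α c η e
      = ∑ e ∈ edges N, ((potential N c e.2 - potential N c e.1) *
          load N (demand N α c η) (direct N α η) e - penalty N c e) :=
        sum_congr rfl fun e he => by rw [h.potential_mul_direct e he, weight, if_pos he]
    _ = ∑ e ∈ edges N, ((potential N c e.2 - potential N c e.1) *
          (∑ k ∈ edges N, q.2 k e) - penalty N c e) := by
        rw [sum_sub_distrib, sum_sub_distrib, h2, ← h1]
        rfl
    _ ≤ _ := sum_le_sum fun e he => h.potential_mul_sub_penalty_le e he _ _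
        (sum_nonneg fun k hk => (hq.2.1 k hk).1 e) (hq.2.2.1 e he) (hq.2.2.2.1 e he).2

/-! ### The solution is basic -/

theorem eq_solution_of_support {g : Fin (N + 1) × Fin (N + 1) → Fin (N + 1) × Fin (N + 1) → ℚ}
    (hg : ∀ k ∈ edges N, IsFlow (edges N) k.1 k.2 (demand N α c η k) (g k))
    (hs : ∀ k ∈ edges N, ∀ e, routing N (demand N α c η) (direct N α η) k e = 0 → g k e = 0)
    (ht : ∀ j, 0 < j → j < N - 1 → ∑ k ∈ edges N, g k (stepEdge N j) = 1) :
    ∀ k ∈ edges N, g k = routing N (demand N α c η) (direct N α η) k := by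
  have hN := h.three_le
  obtain ⟨z, hz⟩ : ∃ z : Fin (N + 1) × Fin (N + 1) → ℚ, ∀ k, z k = g k k := ⟨_, fun _ => rfl⟩
  have hgz : ∀ k ∈ edges N, g k = routing N (demand N α c η) z k := fun k hk =>
    eq_routing_of_support hk (hg k hk)
      (fun e he hc => hs k hk e (by
        simp only [routing, hk, he, chain, hc, if_true, if_false, add_zero])) z (hz k)
  have hlong : z (longEdge N) = direct N α η (longEdge N) := by
    rw [direct_long hN, hz]
    refine hs _ longEdge_mem _ ?_
    have h1 : N ≠ 1 := by omega
    simp [routing, longEdge_mem, chain, longEdge_vals, h1, direct_long hN]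
  have hload : ∀ j, 0 < j → j < N - 1 → load N (demand N α c η) z (stepEdge N j) = 1 :=
    fun j h0 hj => (sum_congr rfl fun k hk => by rw [hgz k hk]).trans (ht j h0 hj)
  have hskip : ∀ j, j < N - 1 → z (skipEdge N j) = direct N α η (skipEdge N j) := by
    intro j
    induction j with
    | zero =>
      intro hj
      rw [hz, direct_skip hj, if_pos rfl]
      refine hs _ (skipEdge_mem hj) _ ?_
      simp [routing, skipEdge_mem hj, chain, skipEdge_vals hj, direct_skip hj]
    | succ j ih =>
      intro hj
      have h1 := hload (j + 1) (by omega) hj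
      have h2 := h.load_direct_inner (j := j + 1) (by omega) hj
      rw [h.load_step _ (by omega), sum_cover_eq (by omega) hj
        fun i => demand N α c η (skipEdge N i) - z (skipEdge N i)] at h1
      rw [h.load_step _ (by omega), sum_cover_eq (by omega) hj
        fun i => demand N α c η (skipEdge N i) - direct N α η (skipEdge N i)] at h2
      have h3 := ih (by omega)
      simp only [Nat.add_sub_cancel] at h1 h2
      linarith
  refine forall_edges (fun i hi => ?_) (fun i hi => ?_) ?_
  · rw [hgz _ (stepEdge_mem hi)]
    exact routing_step hi _ _ _
  · rw [hgz _ (skipEdge_mem hi)]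
    ext e
    simp only [routing, hskip i hi]
  · rw [hgz _ longEdge_mem]
    ext e
    simp only [routing, hlong]

theorem basicOptimal : BasicOptimal (edges N) (capacity N α c η) α
    (weight N α c η, routing N (demand N α c η) (direct N α η)) := by
  refine ⟨⟨h.solution_mem, ?_⟩, fun q hq => h.sum_weight_le hq⟩
  rintro p hp q hq ⟨a, b, ha, hb, hab, hpq⟩
  have hx : ∀ e, a * p.1 e + b * q.1 e = weight N α c η e := fun e =>
    congrFun (congrArg Prod.fst hpq) e
  have hf : ∀ k e, a * p.2 k e + b * q.2 k e =
      routing N (demand N α c η) (direct N α η) k e := fun k e =>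
    congrFun (congrFun (congrArg Prod.snd hpq) k) e
  have key : ∀ k ∈ edges N, p.2 k = routing N (demand N α c η) (direct N α η) k ∧
      q.2 k = routing N (demand N α c η) (direct N α η) k := by
    have hs : ∀ k ∈ edges N, ∀ e, routing N (demand N α c η) (direct N α η) k e = 0 →
        p.2 k e = 0 ∧ q.2 k e = 0 := by
      intro k hk e h0
      have h1 := mul_nonneg ha.le ((hp.2.1 k hk).1 e)
      have h2 := mul_nonneg hb.le ((hq.2.1 k hk).1 e)
      have h3 := hf k e
      rw [h0] at h3
      exact ⟨(mul_eq_zero.1 (by linarith : a * p.2 k e = 0)).resolve_left ha.ne',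
        (mul_eq_zero.1 (by linarith : b * q.2 k e = 0)).resolve_left hb.ne'⟩
    have ht : ∀ j, 0 < j → j < N - 1 → ∑ k ∈ edges N, p.2 k (stepEdge N j) = 1 ∧
        ∑ k ∈ edges N, q.2 k (stepEdge N j) = 1 := by
      intro j h0 hj
      have hj' : j < N := by omega
      have he := stepEdge_mem hj'
      have h1 : a * ∑ k ∈ edges N, p.2 k (stepEdge N j) +
          b * ∑ k ∈ edges N, q.2 k (stepEdge N j) = 1 := by
        rw [mul_sum, mul_sum, ← sum_add_distrib, ← h.load_direct_inner h0 hj]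
        exact sum_congr rfl fun k _ => hf k _
      have h2 := hp.2.2.1 _ he
      have h3 := hq.2.2.1 _ he
      rw [capacity_step hj', mul_one] at h2 h3
      have h4 := h2.trans (hp.2.2.2.1 _ he).2
      have h5 := h3.trans (hq.2.2.2.1 _ he).2
      constructor <;> nlinarith
    exact fun k hk => ⟨h.eq_solution_of_support hp.2.1 (fun k hk e h0 => (hs k hk e h0).1)
      (fun j h0 hj => (ht j h0 hj).1) k hk,
      h.eq_solution_of_support hq.2.1 (fun k hk e h0 => (hs k hk e h0).2)
      (fun j h0 hj => (ht j h0 hj).2) k hk⟩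
  refine Prod.ext (funext fun e => ?_) (funext fun k => ?_)
  · by_cases he : e ∈ edges N
    · have hc := h.capacity_pos e he
      have h1 : weight N α c η e ≤ p.1 e := by
        rw [weight, if_pos he, div_le_iff₀ hc]
        exact (sum_congr rfl fun k hk => by rw [(key k hk).1]).symm.trans_le (hp.2.2.1 e he)
      have h2 : weight N α c η e ≤ q.1 e := by
        rw [weight, if_pos he, div_le_iff₀ hc]
        exact (sum_congr rfl fun k hk => by rw [(key k hk).2]).symm.trans_le (hq.2.2.1 e he)
      have h3 := hx e
      change p.1 e = weight N α c η e
      refine le_antisymm ?_ h1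
      obtain rfl : b = 1 - a := by linarith
      nlinarith
    · rw [hp.2.2.2.2 e he]
      exact (if_neg he).symm
  · by_cases hk : k ∈ edges N
    · exact (key k hk).1
    · rw [hp.1 k hk, h.solution_mem.1 k hk]

theorem card_support_ge :
    2 * (N : ℚ) - 2 ≤ (((edges N).filter fun e => 0 < weight N α c η e).card : ℚ) := by
  have hN := h.three_le
  have hN' : ((N - 2 : ℕ) : ℚ) = N - 2 := by
    push_cast [Nat.cast_sub (show 2 ≤ N by omega)]
    rfl
  rw [card_filter, Nat.cast_sum, sum_edges hN]
  have h1 : ∑ i ∈ range N, (((if 0 < weight N α c η (stepEdge N i) then 1 else 0 : ℕ)) : ℚ) =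
      N := by
    rw [sum_congr rfl fun i hi => ?_, sum_const, card_range, nsmul_one]
    have hi := mem_range.1 hi
    have h2 := h.load_direct_pos hi
    simp [weight, stepEdge_mem hi, capacity_step hi, h2]
  have h2 : (N : ℚ) - 2 ≤
      ∑ i ∈ range (N - 1), (((if 0 < weight N α c η (skipEdge N i) then 1 else 0 : ℕ)) : ℚ) := by
    rw [show N - 1 = N - 2 + 1 by omega, sum_range_succ', sum_congr rfl fun i hi => ?_, sum_const,
      card_range, nsmul_one, hN', le_add_iff_nonneg_right]
    · exact Nat.cast_nonneg _
    · have hi : i + 1 < N - 1 := by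
        have := mem_range.1 hi
        omega
      have h3 := div_pos h.η_pos h.c_pos
      simp [weight, skipEdge_mem hi, load_skip hi, direct_skip hi, capacity_skip hi, h3]
  have h3 : (0 : ℚ) ≤ ((if 0 < weight N α c η (longEdge N) then 1 else 0 : ℕ) : ℚ) :=
    Nat.cast_nonneg _
  linarith

/-! ### A small edge set which suffices -/

theorem exists_routable : ∃ A ⊆ edges N, Routable (edges N) (capacity N α c η)
    (fun p => α * trafficTE (edges N) (capacity N α c η) p) A ∧ A.card ≤ N + 1 := by
  have hN := h.three_le
  have hα := h.α_pos
  have hη := h.η_pos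
  have hc := h.c_pos
  set y : Fin (N + 1) × Fin (N + 1) → ℚ :=
    fun e => if e.2.val = e.1.val + 2 then 0 else demand N α c η e with hy
  have hD : ∀ e ∈ edges N, 0 ≤ demand N α c η e := fun e he =>
    mul_nonneg hα.le (h.capacity_pos e he).le
  have hskip : ∀ i < N - 1, y (skipEdge N i) = 0 := fun i hi => by
    simp [hy, skipEdge_vals hi]
  have hlong : y (longEdge N) = 2 * η := by
    have h1 : N ≠ 2 := by omega
    simp [hy, longEdge_vals, h1, h.demand_long]
  have hsum : ∀ e, ∑ p, routing N (demand N α c η) y p e = load N (demand N α c η) y e :=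
    fun e => (sum_subset (subset_univ _) fun k _ hk => by simp [routing, hk]).symm
  refine ⟨(range N).image (stepEdge N) ∪ {longEdge N}, ?_,
    ⟨routing N (demand N α c η) y, fun p => ?_, ?_, ?_⟩, ?_⟩
  · exact union_subset_union_right subset_union_right
  · by_cases hp : p ∈ edges N
    · have h1 : 0 ≤ y p := ite_nonneg le_rfl (hD p hp)
      have h2 : y p ≤ demand N α c η p := by
        simp only [hy]
        split_ifs
        exacts [hD p hp, le_rfl]
      simpa [trafficTE, hp, demand] using isFlow_routing hN hp h1 h2
    · have h1 : routing N (demand N α c η) y p = 0 := by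
        ext e
        simp [routing, hp]
      simpa [trafficTE, hp, h1] using isFlow_zero (E := edges N) p.1 p.2
  · simp only [hsum]
    refine forall_edges (fun i hi => ?_) (fun i hi => ?_) ?_
    · rw [h.load_step _ hi, hlong, capacity_step hi]
      have h1 := sum_cover_le (N := N) (j := i) (R := α * c)
        (r := fun i => demand N α c η (skipEdge N i) - y (skipEdge N i)) (fun i hi => by
          simp only [hskip i hi, h.demand_skip hi]
          split_ifs <;> linarith) (by positivity)
      linarith [h.saturate]
    · rw [load_skip hi, hskip i hi]
      exact (h.capacity_pos _ (skipEdge_mem hi)).le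
    · rw [load_long hN, hlong, ← h.demand_long]
      exact mul_le_of_le_one_left (h.capacity_pos _ longEdge_mem).le h.α_lt.le
  · simp only [hsum]
    refine forall_edges (fun i hi hA => ?_) (fun i hi _ => ?_) (fun hA => ?_)
    · exact absurd (mem_union_left _ (mem_image_of_mem _ (mem_range.2 hi))) hA
    · rw [load_skip hi, hskip i hi]
    · exact absurd (mem_union_right _ (mem_singleton_self _)) hA
  · refine (card_union_le _ _).trans (Nat.add_le_add (card_image_le.trans ?_) ?_)
    · rw [card_range]
    · rw [card_singleton]

end Admissible

end Instance

end LPGap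

theorem stmt16 (α ε : ℚ) (h0 : 1 / 2 < α) (h1 : α < 1) (hε : 0 < ε) :
    ∃ (n : ℕ) (E : Finset (Fin n × Fin n)) (cap : Fin n × Fin n → ℚ),
      (∀ e ∈ E, e.1 ≠ e.2) ∧ (∀ e ∈ E, 0 < cap e) ∧
      ∃ (x : Fin n × Fin n → ℚ) (f : Fin n × Fin n → Fin n × Fin n → ℚ) (m : ℕ),
        BasicOptimal E cap α (x, f) ∧
        IsLeast {c : ℕ | ∃ A ⊆ E,
          Routable E cap (fun p => α * trafficTE E cap p) A ∧ A.card = c} m ∧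
        (2 - ε) * (m : ℚ) ≤ ((E.filter fun e => 0 < x e).card : ℚ) := by
  obtain ⟨M, hM⟩ := exists_nat_ge (4 / ε)
  rw [div_le_iff₀ hε] at hM
  have hα : 0 < α := by linarith
  set N := 2 * (M + 1) + 1 with hN
  have hNpos : (0 : ℚ) < N := by exact_mod_cast (by omega : 0 < N)
  have hNM : (N : ℚ) = 2 * (M + 1) + 1 := by
    rw [hN]
    push_cast
    ring
  set c := (1 - α) / (2 * α) with hc
  have hsat : 2 * (α * c) = 1 - α := by
    rw [hc]
    field_simp
  have hcpos : 0 < c := div_pos (by linarith) (by linarith)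
  have h : LPGap.Admissible N α c (α * c / (2 * N)) :=
    { three_le := by omega
      odd := ⟨M + 1, hN⟩
      α_pos := hα
      α_lt := h1
      saturate := hsat
      c_pos := hcpos
      c_le := by nlinarith
      η_pos := by positivity
      η_le := le_of_eq (by field_simp) }
  obtain ⟨A, hAE, hA, hcard⟩ := h.exists_routable
  refine ⟨N + 1, LPGap.edges N, LPGap.capacity N α c (α * c / (2 * N)), fun e he heq => ?_,
    h.capacity_pos, _, _, _, h.basicOptimal,
    ⟨Nat.sInf_mem ⟨_, A, hAE, hA, rfl⟩, fun _ hm => Nat.sInf_le hm⟩, ?_⟩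
  · have := LPGap.lt_of_mem_edges h.three_le e he
    rw [heq] at this
    exact lt_irrefl _ this
  · refine le_trans ?_ h.card_support_ge
    set m := sInf {c' : ℕ | ∃ A ⊆ LPGap.edges N, Routable (LPGap.edges N)
      (LPGap.capacity N α c (α * c / (2 * N)))
      (fun p => α * trafficTE (LPGap.edges N) (LPGap.capacity N α c (α * c / (2 * N))) p) A ∧
        A.card = c'}
    have hm : (m : ℚ) ≤ N + 1 := by
      have hm' : m ≤ N + 1 := le_trans (Nat.sInf_le ⟨A, hAE, hA, rfl⟩) hcard
      exact_mod_cast hm'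
    have hm0 : (0 : ℚ) ≤ m := Nat.cast_nonneg m
    have hM0 : (0 : ℚ) ≤ M := Nat.cast_nonneg M
    rcases le_total ε 2 with h2 | h2
    · have := mul_le_mul_of_nonneg_left hm (sub_nonneg.2 h2)
      nlinarith
    · have := mul_nonneg (sub_nonneg.2 h2) hm0
      nlinarith
end
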